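/- arXiv:1507.08842 — 2 statements merged into one kernel-verified Lean document; each statement's English description precedes it below -/
import Mathlib

section
/- Let φ: ℂ×ℝ→ℝ be real-analytic near the origin with φ(0,0)=0 and vanishing first derivatives at (0,0), and with ∂²φ/∂z∂z̄(0,0) > 0 (Wirtinger derivatives in z), and set M = {(z,w) ∈ ℂ² : Im w = φ(z, Re w)}, a germ at 0 of a strictly pseudoconvex real-analytic hypersurface, with defining function ρ(z,w) = Im w − φ(z, Re w). Let ψ: ℂ²×ℝ→ℝ be real-analytic near the origin with ψ(0)=0 and vanishing first derivatives at 0, and set M' = {(z₁',z₂',w') ∈ ℂ³ : Im w' = ψ(z₁',z₂', Re w')}, with defining function ρ'(z₁',z₂',w') = Im w' − ψ(z₁',z₂',Re w'). Let H = (H₁,H₂,H₃) be holomorphic near 0 ∈ ℂ² with H(0)=0, with injective differential at 0, mapping all points of M near 0 into M', transversal at 0 (i.e. (∂H₃/∂z(0), ∂H₃/∂w(0)) ≠ (0,0)), and 2-nondegenerate at 0, meaning: with the CR operator L := (∂ρ/∂w̄)·∂/∂z̄ − (∂ρ/∂z̄)·∂/∂w̄ and G(z,w) := (∂ρ'/∂z₁',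 ∂ρ'/∂z₂', ∂ρ'/∂w') evaluated at (H(z,w), conj H(z,w)) ∈ ℂ³, the three vectors G(0), (LG)(0), (L²G)(0) span ℂ³ while G(0), (LG)(0) alone do not. Assume that the only triple (α,β,γ) of functions holomorphic near 0 ∈ ℂ², vanishing at 0, which satisfies Re( α·∂ρ'/∂z₁'(H,conj H) + β·∂ρ'/∂z₂'(H,conj H) + γ·∂ρ'/∂w'(H,conj H) ) = 0 at every point of M near 0, is the triple vanishing identically near 0. Then H is isolated among such maps: there exist r > 0 and δ > 0 such that every holomorphic map Ĥ on the ball B_r(0) ⊂ ℂ² with Ĥ(0)=0, mapping M∩B_r(0) into M', transversal and 2-nondegenerate at 0 (with the same definitions), and satisfying sup_{B_r(0)} |Ĥ − H| < δ, coincides with H on B_r(0). -/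
open Complex Filter Topology Metric

/-- Wirtinger derivative in the complex direction `v`:
`∂_v f = ½(∂f/∂x − i·∂f/∂y)`, where `x`,`y` are the real coordinates along `v`, `iv`. -/
noncomputable def wDer {E F : Type*} [NormedAddCommGroup E] [NormedSpace ℂ E]
    [NormedAddCommGroup F] [NormedSpace ℂ F] (v : E) (f : E → F) (p : E) : F :=
  (2⁻¹ : ℂ) • (fderiv ℝ f p v - Complex.I • fderiv ℝ f p (Complex.I • v))

/-- Conjugate Wirtinger derivative: `∂̄_v f = ½(∂f/∂x + i·∂f/∂y)`. -/
noncomputable def wDerBar {E F : Type*} [NormedAddCommGroup E] [NormedSpace ℂ E]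
    [NormedAddCommGroup F] [NormedSpace ℂ F] (v : E) (f : E → F) (p : E) : F :=
  (2⁻¹ : ℂ) • (fderiv ℝ f p v + Complex.I • fderiv ℝ f p (Complex.I • v))

/-- Wirtinger `z`-derivative for functions on `ℂ × ℝ`. -/
noncomputable def wzPhi (f : ℂ × ℝ → ℂ) (p : ℂ × ℝ) : ℂ :=
  2⁻¹ * (fderiv ℝ f p (1, 0) - Complex.I * fderiv ℝ f p (Complex.I, 0))

/-- Conjugate Wirtinger `z̄`-derivative for functions on `ℂ × ℝ`. -/
noncomputable def wzBarPhi (f : ℂ × ℝ → ℂ) (p : ℂ × ℝ) : ℂ :=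
  2⁻¹ * (fderiv ℝ f p (1, 0) + Complex.I * fderiv ℝ f p (Complex.I, 0))

/-- The hypersurface `M = {Im w = φ(z, Re w)} ⊂ ℂ²`. -/
def Mset (φ : ℂ × ℝ → ℝ) : Set (ℂ × ℂ) := {p | p.2.im = φ (p.1, p.2.re)}

/-- The hypersurface `M' = {Im w' = ψ(z₁', z₂', Re w')} ⊂ ℂ³`. -/
def M'set (ψ : ℂ × ℂ × ℝ → ℝ) : Set (ℂ × ℂ × ℂ) :=
  {q | q.2.2.im = ψ (q.1, q.2.1, q.2.2.re)}

/-- The defining function `ρ(z,w) = Im w − φ(z, Re w)` of `M`, complex-valued. -/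
noncomputable def rhoC (φ : ℂ × ℝ → ℝ) : ℂ × ℂ → ℂ :=
  fun p => ((p.2.im - φ (p.1, p.2.re) : ℝ) : ℂ)

/-- The defining function `ρ'(z₁',z₂',w') = Im w' − ψ(z₁',z₂',Re w')` of `M'`,
complex-valued. -/
noncomputable def rhoC' (ψ : ℂ × ℂ × ℝ → ℝ) : ℂ × ℂ × ℂ → ℂ :=
  fun q => ((q.2.2.im - ψ (q.1, q.2.1, q.2.2.re) : ℝ) : ℂ)

/-- The Wirtinger gradient `(∂ρ'/∂z₁', ∂ρ'/∂z₂', ∂ρ'/∂w')` of `ρ'`, pulled back by `H`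
(this is `ρ'_{Z'}` evaluated at `(H, conj H)`). -/
noncomputable def Gmap (ψ : ℂ × ℂ × ℝ → ℝ) (H : ℂ × ℂ → ℂ × ℂ × ℂ) :
    ℂ × ℂ → ℂ × ℂ × ℂ := fun p =>
  (wDer ((1 : ℂ), (0 : ℂ), (0 : ℂ)) (rhoC' ψ) (H p),
   wDer ((0 : ℂ), (1 : ℂ), (0 : ℂ)) (rhoC' ψ) (H p),
   wDer ((0 : ℂ), (0 : ℂ), (1 : ℂ)) (rhoC' ψ) (H p))

/-- The CR operator `L = (∂ρ/∂w̄)·∂/∂z̄ − (∂ρ/∂z̄)·∂/∂w̄` of `M`, acting on `ℂ³`-valued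
functions on `ℂ²`. -/
noncomputable def Lop (φ : ℂ × ℝ → ℝ) (G : ℂ × ℂ → ℂ × ℂ × ℂ) :
    ℂ × ℂ → ℂ × ℂ × ℂ := fun p =>
  (wDerBar ((0 : ℂ), (1 : ℂ)) (rhoC φ) p) • wDerBar ((1 : ℂ), (0 : ℂ)) G p
    - (wDerBar ((1 : ℂ), (0 : ℂ)) (rhoC φ) p) • wDerBar ((0 : ℂ), (1 : ℂ)) G p

/-- Transversality of `H` at `0`: `(∂H₃/∂z(0), ∂H₃/∂w(0)) ≠ (0,0)`. -/
noncomputable def TransversalAt (H : ℂ × ℂ → ℂ × ℂ × ℂ) : Prop :=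
  (fderiv ℂ (fun p => (H p).2.2) 0 ((1 : ℂ), (0 : ℂ)),
    fderiv ℂ (fun p => (H p).2.2) 0 ((0 : ℂ), (1 : ℂ))) ≠ (0, 0)

/-- `2`-nondegeneracy of `H` at `0`: `G(0), (LG)(0), (L²G)(0)` span `ℂ³`, while
`G(0), (LG)(0)` alone do not. -/
noncomputable def TwoNondegAt (φ : ℂ × ℝ → ℝ) (ψ : ℂ × ℂ × ℝ → ℝ)
    (H : ℂ × ℂ → ℂ × ℂ × ℂ) : Prop :=
  Submodule.span ℂ {Gmap ψ H 0, Lop φ (Gmap ψ H) 0, Lop φ (Lop φ (Gmap ψ H)) 0} = ⊤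
    ∧ Submodule.span ℂ {Gmap ψ H 0, Lop φ (Gmap ψ H) 0} ≠ ⊤

/-- `α = (α₁,α₂,α₃)` is an infinitesimal deformation of `H : M → M'`: it is holomorphic
near `0`, vanishes at `0`, and `Re(α₁·ρ'_{z₁'}(H,conj H) + α₂·ρ'_{z₂'}(H,conj H)
+ α₃·ρ'_{w'}(H,conj H)) = 0` on `M` near `0`. -/
noncomputable def IsInfDef (φ : ℂ × ℝ → ℝ) (ψ : ℂ × ℂ × ℝ → ℝ)
    (H : ℂ × ℂ → ℂ × ℂ × ℂ) (α : ℂ × ℂ → ℂ × ℂ × ℂ) : Prop :=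
  AnalyticAt ℂ α 0 ∧ α 0 = 0 ∧
    ∀ᶠ p in 𝓝 (0 : ℂ × ℂ), p ∈ Mset φ →
      ((α p).1 * (Gmap ψ H p).1 + (α p).2.1 * (Gmap ψ H p).2.1
        + (α p).2.2 * (Gmap ψ H p).2.2).re = 0


/-- Complexification of a real-analytic function. -/
theorem cx_exists {E E' : Type*} [NormedAddCommGroup E] [NormedSpace ℝ E]
    [NormedAddCommGroup E'] [NormedSpace ℂ E'] {ι : Type*} [Fintype ι] [DecidableEq ι] (e : ι → E)
    (c : ι → E' →L[ℂ] ℂ) (J : E → E') (t : E → ι → ℝ)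
    (hc : ∀ x i, c i (J x) = (t x i : ℂ)) (hx : ∀ x, x = ∑ i, t x i • e i)
    (f : E → ℝ) (hf : AnalyticAt ℝ f 0) :
    ∃ F : E' → ℂ, AnalyticAt ℂ F 0 ∧ ∀ᶠ x in 𝓝 (0 : E), F (J x) = (f x : ℂ) := by
  obtain ⟨p, r, hp⟩ := hf
  obtain ⟨Ce, hCe0, hCe⟩ : ∃ C : ℝ, 0 ≤ C ∧ ∀ i, ‖e i‖ ≤ C :=
    ⟨∑ i, ‖e i‖, Finset.sum_nonneg (fun _ _ => norm_nonneg _),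
      fun i => Finset.single_le_sum (f := fun i => ‖e i‖) (fun _ _ => norm_nonneg _) (Finset.mem_univ i)⟩
  obtain ⟨Cc, hCc0, hCc⟩ : ∃ C : ℝ, 0 ≤ C ∧ ∀ i, ‖c i‖ ≤ C :=
    ⟨∑ i, ‖c i‖, Finset.sum_nonneg (fun _ _ => norm_nonneg _),
      fun i => Finset.single_le_sum (f := fun i => ‖c i‖) (fun _ _ => norm_nonneg _) (Finset.mem_univ i)⟩
  obtain ⟨r', hr'0, hr'⟩ : ∃ r' : NNReal, 0 < r' ∧ (r' : ENNReal) < p.radius := by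
    obtain ⟨r', h1, h2⟩ := ENNReal.lt_iff_exists_nnreal_btwn.mp (lt_of_lt_of_le hp.r_pos hp.r_le)
    exact ⟨r', by exact_mod_cast h1, h2⟩
  obtain ⟨C, hC0, hC⟩ := p.norm_mul_pow_le_of_lt_radius hr'
  let q : FormalMultilinearSeries ℂ E' ℂ := fun n =>
    ∑ s : Fin n → ι, ((ContinuousMultilinearMap.mkPiAlgebra ℂ (Fin n) ℂ).compContinuousLinearMap
      (fun k => c (s k))).smulRight ((p n (fun k => e (s k)) : ℝ) : ℂ)
  have hqa : ∀ n (v : Fin n → E'), q n v = ∑ s : Fin n → ι, (∏ k, c (s k) (v k)) *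
      ((p n (fun k => e (s k)) : ℝ) : ℂ) := by
    intro n v
    simp [q]
  have hqn : ∀ n, ‖q n‖ ≤ (Fintype.card ι * (Cc * Ce)) ^ n * ‖p n‖ := by
    intro n
    refine ContinuousMultilinearMap.opNorm_le_bound (by positivity) (fun v => ?_)
    rw [hqa]
    calc _ ≤ ∑ s : Fin n → ι, (Cc ^ n * ∏ k, ‖v k‖) * (‖p n‖ * Ce ^ n) := by
          refine norm_sum_le_of_le _ (fun s _ => ?_)
          rw [norm_mul]
          gcongr
          · rw [norm_prod]
            calc _ ≤ ∏ k, (Cc * ‖v k‖) := by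
                  refine Finset.prod_le_prod (fun _ _ => norm_nonneg _) (fun k _ => ?_)
                  exact (c (s k)).le_of_opNorm_le (hCc _) _
              _ = _ := by rw [Finset.prod_mul_distrib]; simp
          · rw [Complex.norm_real]
            exact (p n).le_opNorm_mul_pow_of_le ((pi_norm_le_iff_of_nonneg hCe0).2 (fun k => hCe _))
      _ = _ := by
          simp only [Finset.sum_const, Finset.card_univ, Fintype.card_fun, Fintype.card_fin, nsmul_eq_mul]
          push_cast
          rw [mul_pow, mul_pow]; ring
  have hdiag : ∀ n x, q n (fun _ => J x) = ((p n (fun _ => x) : ℝ) : ℂ) := by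
    intro n x
    rw [hqa]
    conv_rhs => rw [show (fun _ : Fin n => x) = (fun _ : Fin n => ∑ i, t x i • e i) from
      funext fun _ => hx x]
    rw [ContinuousMultilinearMap.map_sum]
    push_cast
    refine Finset.sum_congr rfl (fun s _ => ?_)
    rw [ContinuousMultilinearMap.map_smul_univ]
    simp [hc]
  have hqr : 0 < q.radius := by
    set K : ℝ := Fintype.card ι * (Cc * Ce) + 1 with hK
    have hKp : 0 < K := by positivity
    have : ((r' / ⟨K, hKp.le⟩ : NNReal) : ENNReal) ≤ q.radius := by
      refine q.le_radius_of_bound C (fun n => ?_)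
      have h0 : ((r' / ⟨K, hKp.le⟩ : NNReal) : ℝ) = r' / K := rfl
      rw [h0, div_pow]
      have h1 : ‖q n‖ ≤ K ^ n * ‖p n‖ := (hqn n).trans (by
        gcongr; simp [hK])
      calc ‖q n‖ * ((r':ℝ) ^ n / K ^ n) ≤ (K ^ n * ‖p n‖) * ((r':ℝ) ^ n / K ^ n) := by gcongr
        _ = ‖p n‖ * (r':ℝ) ^ n := by field_simp
        _ ≤ C := hC n
    refine lt_of_lt_of_le ?_ this
    rw [ENNReal.coe_pos]
    exact div_pos hr'0 (by exact_mod_cast hKp)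
  refine ⟨q.sum, ⟨q, q.radius, q.hasFPowerSeriesOnBall hqr⟩, ?_⟩
  filter_upwards [Metric.eball_mem_nhds (0:E) hp.r_pos] with x hx1
  have h2 := hp.hasSum (y := x) hx1
  rw [zero_add] at h2
  have h2' : HasSum (fun n => ((p n (fun _ => x) : ℝ) : ℂ)) (f x : ℂ) :=
    Complex.hasSum_ofReal.2 h2
  simp only [FormalMultilinearSeries.sum, hdiag]
  exact h2'.tsum_eq

theorem analyticAt_star_star {E F : Type*} [NormedAddCommGroup E] [NormedSpace ℂ E]
    [StarAddMonoid E] [StarModule ℂ E] [NormedStarGroup E]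
    [NormedAddCommGroup F] [NormedSpace ℂ F]
    [StarAddMonoid F] [StarModule ℂ F] [NormedStarGroup F] {f : E → F} {x : E}
    (hf : AnalyticAt ℂ f (star x)) : AnalyticAt ℂ (fun y => star (f (star y))) x := by
  obtain ⟨p, r, hp⟩ := hf
  let q : FormalMultilinearSeries ℂ E F := fun n =>
    MultilinearMap.mkContinuous
      { toFun := fun v => star (p n (fun k => star (v k)))
        map_update_add' := by
          intro _ m i x y
          have h : ∀ z, (fun k => star (Function.update m i z k)) =
              Function.update (fun k => star (m k)) i (star z) := by
            intro z; ext k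
            by_cases hk : k = i
            · subst hk; simp
            · simp [hk]
          rw [h, h, h, star_add, ContinuousMultilinearMap.map_update_add, star_add]
        map_update_smul' := by
          intro _ m i c x
          have h : ∀ z, (fun k => star (Function.update m i z k)) =
              Function.update (fun k => star (m k)) i (star z) := by
            intro z; ext k
            by_cases hk : k = i
            · subst hk; simp
            · simp [hk]
          rw [h, h, star_smul, ContinuousMultilinearMap.map_update_smul, star_smul, star_star] }
      ‖p n‖ (by
        intro v
        simp only [MultilinearMap.coe_mk, norm_star]
        exact ((p n).le_opNorm _).trans (by simp))
  have hq : ∀ n, ‖q n‖ ≤ ‖p n‖ := fun n => MultilinearMap.mkContinuous_norm_le _ (norm_nonneg _) _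
  refine ⟨q, r, ⟨?_, hp.r_pos, ?_⟩⟩
  · refine hp.r_le.trans ?_
    exact FormalMultilinearSeries.radius_le_of_le (fun n => hq n) 
  · intro y hy
    have h1 := hp.hasSum (y := star y) (by simpa [enorm_eq_nnnorm, nnnorm_star] using hy)
    have h2 := h1.star
    simpa [q, star_add] using h2


section montel

variable {F : Type*} [NormedAddCommGroup F] [NormedSpace ℂ F]

theorem dbl_summable {c : ℕ × ℕ → F} (hc : ∀ i, ‖c i‖ ≤ 1) {ρ : ℝ} (h0 : 0 ≤ ρ)
    {p : ℂ × ℂ} (hp : ‖p‖ ≤ ρ) (i : ℕ × ℕ) :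
    ‖(p.1 ^ i.1 * p.2 ^ i.2) • c i‖ ≤ ρ ^ i.1 * ρ ^ i.2 := by
  rw [norm_smul, norm_mul, norm_pow, norm_pow]
  have h3 := (norm_fst_le p).trans hp
  have h4 := (norm_snd_le p).trans hp
  calc _ ≤ ρ ^ i.1 * ρ ^ i.2 * 1 := by
        gcongr
        exact hc i
    _ = _ := mul_one _

theorem geo_summable {ρ : ℝ} (h0 : 0 ≤ ρ) (h1 : ρ < 1) :
    Summable (fun i : ℕ × ℕ => ρ ^ i.1 * ρ ^ i.2) :=
  Summable.mul_of_nonneg (summable_geometric_of_lt_one h0 h1)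
    (summable_geometric_of_lt_one h0 h1) (fun _ => pow_nonneg h0 _) (fun _ => pow_nonneg h0 _)

theorem dbl_analytic [CompleteSpace F] {c : ℕ × ℕ → F} (hc : ∀ i, ‖c i‖ ≤ 1) :
    AnalyticOnNhd ℂ (fun p : ℂ × ℂ => ∑' i : ℕ × ℕ, (p.1 ^ i.1 * p.2 ^ i.2) • c i) (ball 0 1) := by
  let q : FormalMultilinearSeries ℂ (ℂ × ℂ) F := fun n =>
    ∑ i ∈ Finset.HasAntidiagonal.antidiagonal n,
      ((ContinuousMultilinearMap.mkPiAlgebra ℂ (Fin n) ℂ).compContinuousLinearMap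
      (fun k => if (k : ℕ) < i.1 then ContinuousLinearMap.fst ℂ ℂ ℂ
        else ContinuousLinearMap.snd ℂ ℂ ℂ)).smulRight (c i)
  have hqa : ∀ n (v : Fin n → ℂ × ℂ), q n v = ∑ i ∈ Finset.HasAntidiagonal.antidiagonal n,
      (∏ k : Fin n, (if (k : ℕ) < i.1 then (v k).1 else (v k).2)) • c i := by
    intro n v
    simp only [q, _root_.sum_apply]
    refine Finset.sum_congr rfl (fun i _ => ?_)
    simp only [ContinuousMultilinearMap.smulRight_apply,
      ContinuousMultilinearMap.compContinuousLinearMap_apply,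
      ContinuousMultilinearMap.mkPiAlgebra_apply]
    congr 1
    refine Finset.prod_congr rfl (fun k _ => ?_)
    split_ifs <;> rfl
  have hqn : ∀ n, ‖q n‖ ≤ n + 1 := by
    intro n
    refine ContinuousMultilinearMap.opNorm_le_bound (by positivity) (fun v => ?_)
    rw [hqa]
    calc _ ≤ ∑ i ∈ Finset.HasAntidiagonal.antidiagonal n, ∏ k, ‖v k‖ := by
          refine norm_sum_le_of_le _ (fun s _ => ?_)
          rw [norm_smul, norm_prod]
          refine (mul_le_of_le_one_right (by positivity) (hc _)).trans ?_
          refine Finset.prod_le_prod (fun _ _ => norm_nonneg _) (fun k _ => ?_)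
          split_ifs
          · exact norm_fst_le _
          · exact norm_snd_le _
      _ = _ := by simp
  have hdiag : ∀ n (x : ℂ × ℂ), q n (fun _ => x) =
      ∑ i ∈ Finset.HasAntidiagonal.antidiagonal n, (x.1 ^ i.1 * x.2 ^ i.2) • c i := by
    intro n x
    rw [hqa]
    refine Finset.sum_congr rfl (fun i hi => ?_)
    have hi' : i.1 + i.2 = n := by simpa using hi
    congr 1
    subst hi'
    rw [Fin.prod_univ_eq_prod_range (fun k => if k < i.1 then x.1 else x.2), Finset.prod_range_add]
    congr 1
    · rw [Finset.prod_congr rfl (g := fun _ => x.1)]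
      · simp
      · intro k hk; simp at hk; simp [hk]
    · simp
  have hr : (1 : ENNReal) ≤ q.radius := by
    refine le_of_forall_lt (fun a ha => ?_)
    obtain ⟨b, hab, hb⟩ := ENNReal.lt_iff_exists_nnreal_btwn.mp ha
    refine lt_of_lt_of_le hab (q.le_radius_of_isBigO ?_)
    have hb1 : (b : ℝ) < 1 := by exact_mod_cast hb
    have h1 : Tendsto (fun n : ℕ => ((n : ℝ) + 1) * (b : ℝ) ^ n) atTop (𝓝 0) := by
      have h2 := tendsto_self_mul_const_pow_of_lt_one b.2 hb1
      have h3 := tendsto_pow_atTop_nhds_zero_of_lt_one b.2 hb1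
      simpa [add_mul] using h2.add h3
    refine Asymptotics.IsBigO.trans ?_ (h1.isBigO_one ℝ)
    refine Asymptotics.IsBigO.of_bound 1 (Eventually.of_forall fun n => ?_)
    rw [one_mul, Real.norm_of_nonneg (by positivity), Real.norm_of_nonneg (by positivity)]
    gcongr
    exact hqn n
  have hmain : HasFPowerSeriesOnBall
      (fun p : ℂ × ℂ => ∑' i : ℕ × ℕ, (p.1 ^ i.1 * p.2 ^ i.2) • c i) q 0 1 := by
    refine ⟨hr, by simp, ?_⟩
    intro y hy
    have hy1 : ‖y‖ < 1 := by
      rw [Metric.mem_eball, edist_zero_right] at hy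
      rw [← toReal_enorm]
      have := (ENNReal.toReal_lt_toReal (ne_top_of_lt hy) (by simp)).2 hy
      simpa using this
    have hs : Summable (fun i : ℕ × ℕ => (y.1 ^ i.1 * y.2 ^ i.2) • c i) :=
      Summable.of_norm_bounded (geo_summable (norm_nonneg y) hy1)
        (dbl_summable hc (norm_nonneg y) le_rfl)
    have h1 := hs.hasSum
    rw [← (Finset.HasAntidiagonal.sigmaAntidiagonalEquivProd (A := ℕ)).hasSum_iff] at h1
    have h2 := h1.sigma (fun n => hasSum_fintype _)
    rw [zero_add]
    convert! h2 using 2 with n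
    rw [hdiag, ← Finset.sum_coe_sort]
    rfl
  have := hmain.analyticOnNhd
  rwa [show Metric.eball (0 : ℂ × ℂ) 1 = ball 0 1 by
    rw [← Metric.eball_ofReal]; simp] at this

end montel

theorem an_clm_apply {E F G : Type*} [NormedAddCommGroup E] [NormedSpace ℂ E]
    [NormedAddCommGroup F] [NormedSpace ℂ F] [NormedAddCommGroup G] [NormedSpace ℂ G]
    {f : E → F →L[ℂ] G} {x : E} (hf : AnalyticAt ℂ f x) (v : F) :
    AnalyticAt ℂ (fun y => f y v) x :=
  ((ContinuousLinearMap.apply ℂ G v).analyticAt _).comp hf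

section montel2

variable {F : Type*} [NormedAddCommGroup F] [NormedSpace ℂ F] [CompleteSpace F]

/-- Iterated partial derivative in the first variable. -/
noncomputable def pd1 (f : ℂ × ℂ → F) : ℕ → ℂ × ℂ → F
  | 0 => f
  | (j + 1) => fun p => fderiv ℂ (pd1 f j) p (1, 0)

theorem pd1_analytic {f : ℂ × ℂ → F} {U : Set (ℂ × ℂ)} (hf : AnalyticOnNhd ℂ f U) (j : ℕ) :
    AnalyticOnNhd ℂ (pd1 f j) U := by
  induction j with
  | zero => exact hf
  | succ j ih =>
    intro p hp
    exact an_clm_apply (ih p hp).fderiv (1, 0)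

theorem pd1_eq {f : ℂ × ℂ → F} {U : Set (ℂ × ℂ)} (hU : IsOpen U) (hf : AnalyticOnNhd ℂ f U)
    (j : ℕ) : ∀ p ∈ U, iteratedDeriv j (fun z => f (z, p.2)) p.1 = pd1 f j p := by
  induction j with
  | zero => intro p hp; simp [pd1]
  | succ j ih =>
    intro p hp
    rw [iteratedDeriv_succ]
    have h1 : (iteratedDeriv j fun z => f (z, p.2)) =ᶠ[𝓝 p.1] (fun z => pd1 f j (z, p.2)) := by
      have hc : ContinuousAt (fun z : ℂ => (z, p.2)) p.1 := by fun_prop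
      filter_upwards [hc.preimage_mem_nhds (hU.mem_nhds hp)] with z hz
      exact ih (z, p.2) hz
    rw [h1.deriv_eq]
    have h2 : HasDerivAt (fun z : ℂ => (z, p.2)) ((1 : ℂ), (0 : ℂ)) p.1 :=
      (hasDerivAt_id p.1).prodMk (hasDerivAt_const p.1 p.2)
    exact ((pd1_analytic hf j p hp).differentiableAt.hasFDerivAt.comp_hasDerivAt p.1 h2).deriv

theorem dbl_expand {f : ℂ × ℂ → F} {U : Set (ℂ × ℂ)} (hU : IsOpen U) (hf : AnalyticOnNhd ℂ f U)
    (hUb : closedBall 0 1 ⊆ U) (hb : ∀ p ∈ closedBall (0 : ℂ × ℂ) 1, ‖f p‖ ≤ 1) :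
    ∃ c : ℕ × ℕ → F, (∀ i, ‖c i‖ ≤ 1) ∧ ∀ p ∈ ball (0 : ℂ × ℂ) 1,
      f p = ∑' i : ℕ × ℕ, (p.1 ^ i.1 * p.2 ^ i.2) • c i := by
  have hmem : ∀ z u : ℂ, z ∈ closedBall (0 : ℂ) 1 → u ∈ closedBall (0 : ℂ) 1 →
      (z, u) ∈ closedBall (0 : ℂ × ℂ) 1 := by
    intro z u hz hu
    rw [← closedBall_prod_same]; exact ⟨hz, hu⟩
  have hd1 : ∀ u ∈ closedBall (0 : ℂ) 1, DifferentiableOn ℂ (fun z => f (z, u)) (closedBall 0 1) := by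
    intro u hu z hz
    have h := (hf (z, u) (hUb (hmem z u hz hu))).differentiableAt
    exact (h.comp z (f := fun z : ℂ => (z, u)) (by fun_prop)).differentiableWithinAt
  let a : ℕ → ℂ → F := fun j u => (j.factorial : ℂ)⁻¹ • pd1 f j (0, u)
  have hda : ∀ j, DifferentiableOn ℂ (a j) (closedBall 0 1) := by
    intro j u hu
    have h := (pd1_analytic hf j (0, u) (hUb (hmem 0 u (by simp) hu))).differentiableAt
    exact ((h.comp u (f := fun u : ℂ => ((0 : ℂ), u)) (by fun_prop)).const_smul _).differentiableWithinAt
  have hdc : ∀ g : ℂ → F, DifferentiableOn ℂ g (closedBall 0 1) → DiffContOnCl ℂ g (ball 0 1) := by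
    intro g hg
    refine ⟨hg.mono ball_subset_closedBall, ?_⟩
    rw [closure_ball _ one_ne_zero]; exact hg.continuousOn
  have hfac : ∀ n : ℕ, ∀ x : F, ‖x‖ ≤ n.factorial * 1 / 1 ^ n → ‖(n.factorial : ℂ)⁻¹ • x‖ ≤ 1 := by
    intro n x hx
    rw [norm_smul, norm_inv, Complex.norm_natCast, inv_mul_le_iff₀ (by positivity)]
    simpa using hx
  have hab : ∀ j, ∀ u ∈ closedBall (0 : ℂ) 1, ‖a j u‖ ≤ 1 := by
    intro j u hu
    have h1 := norm_iteratedDeriv_le_of_forall_mem_sphere_norm_le j one_pos (hdc _ (hd1 u hu))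
      (fun z hz => hb (z, u) (hmem z u (sphere_subset_closedBall hz) hu))
    have h2 := pd1_eq hU hf j (0, u) (hUb (hmem 0 u (by simp) hu))
    simp only at h2
    rw [h2] at h1
    exact hfac j _ h1
  let c : ℕ × ℕ → F := fun i => (i.2.factorial : ℂ)⁻¹ • iteratedDeriv i.2 (a i.1) 0
  have hc : ∀ i, ‖c i‖ ≤ 1 := by
    intro i
    have h1 := norm_iteratedDeriv_le_of_forall_mem_sphere_norm_le i.2 one_pos (hdc _ (hda i.1))
      (fun z hz => hab i.1 z (sphere_subset_closedBall hz))
    exact hfac _ _ h1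
  refine ⟨c, hc, ?_⟩
  intro p hp
  have hp' := hp
  rw [← ball_prod_same] at hp'
  obtain ⟨hp1, hp2⟩ := hp'
  have hs : Summable (fun i : ℕ × ℕ => (p.1 ^ i.1 * p.2 ^ i.2) • c i) :=
    Summable.of_norm_bounded (geo_summable (norm_nonneg p) (by simpa using hp))
      (dbl_summable hc (norm_nonneg p) le_rfl)
  rw [hs.tsum_prod]
  have e1 := taylorSeries_eq_on_ball ((hd1 p.2 (ball_subset_closedBall hp2)).mono ball_subset_closedBall) hp1
  refine e1.symm.trans (tsum_congr fun j => ?_)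
  have e2 := taylorSeries_eq_on_ball ((hda j).mono ball_subset_closedBall) hp2
  have h2 := pd1_eq hU hf j (0, p.2) (hUb (hmem 0 p.2 (by simp) (ball_subset_closedBall hp2)))
  simp only at h2
  rw [h2, smul_comm, sub_zero]
  change p.1 ^ j • a j p.2 = _
  rw [← e2, ← tsum_const_smul'']
  refine tsum_congr fun k => ?_
  simp only [sub_zero, c, smul_smul]
  ring_nf

theorem montel2 [ProperSpace F] {f : ℕ → ℂ × ℂ → F} {U : Set (ℂ × ℂ)} (hU : IsOpen U)
    (hf : ∀ n, AnalyticOnNhd ℂ (f n) U)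
    (hUb : closedBall 0 1 ⊆ U) (hb : ∀ n, ∀ p ∈ closedBall (0 : ℂ × ℂ) 1, ‖f n p‖ ≤ 1) :
    ∃ (g : ℂ × ℂ → F) (θ : ℕ → ℕ), StrictMono θ ∧ AnalyticOnNhd ℂ g (ball 0 1) ∧
      ∀ (x : ℕ → ℂ × ℂ) (p : ℂ × ℂ), p ∈ ball (0 : ℂ × ℂ) 1 → Tendsto x atTop (𝓝 p) →
        Tendsto (fun n => f (θ n) (x n)) atTop (𝓝 (g p)) := by
  choose c hc1 hc2 using fun n => dbl_expand hU (hf n) hUb (hb n)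
  have hK : IsCompact (Set.pi Set.univ (fun _ : ℕ × ℕ => closedBall (0 : F) 1)) :=
    isCompact_univ_pi (fun _ => isCompact_closedBall _ _)
  obtain ⟨c0, hc0, θ, hθ, hlim⟩ := hK.isSeqCompact (x := c) (fun n i _ => by simpa using hc1 n i)
  have hc0' : ∀ i, ‖c0 i‖ ≤ 1 := fun i => by simpa using hc0 i (Set.mem_univ i)
  refine ⟨_, θ, hθ, dbl_analytic hc0', ?_⟩
  intro x p hp hx
  have hp1 : ‖p‖ < 1 := by simpa using hp
  obtain ⟨ρ, hρ1, hρ2⟩ := exists_between hp1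
  have hρ0 : 0 ≤ ρ := (norm_nonneg p).trans hρ1.le
  have hev : ∀ᶠ n in atTop, ‖x n‖ < ρ := (hx.norm).eventually_lt_const hρ1
  have h1 : Tendsto (fun n => ∑' i : ℕ × ℕ, ((x n).1 ^ i.1 * (x n).2 ^ i.2) • c (θ n) i) atTop
      (𝓝 (∑' i : ℕ × ℕ, (p.1 ^ i.1 * p.2 ^ i.2) • c0 i)) := by
    refine tendsto_tsum_of_dominated_convergence (geo_summable hρ0 hρ2) (fun i => ?_) ?_
    · have hx1 : Tendsto (fun n => (x n).1) atTop (𝓝 p.1) := (continuous_fst.tendsto p).comp hx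
      have hx2 : Tendsto (fun n => (x n).2) atTop (𝓝 p.2) := (continuous_snd.tendsto p).comp hx
      exact ((hx1.pow _).mul (hx2.pow _)).smul ((tendsto_pi_nhds.1 hlim) i)
    · filter_upwards [hev] with n hn i
      exact dbl_summable (hc1 _) hρ0 hn.le i
  refine h1.congr' ?_
  filter_upwards [hev] with n hn
  exact (hc2 (θ n) (x n) (by simpa using hn.trans hρ2)).symm

end montel2

theorem ident_tr {F : ℂ × ℂ × ℂ → ℂ} {ρ : ℝ} (hF : DifferentiableOn ℂ F (ball 0 ρ))
    (h0 : ∀ (z : ℂ) (s : ℝ), ((z, star z, (s : ℂ)) : ℂ × ℂ × ℂ) ∈ ball (0 : ℂ × ℂ × ℂ) ρ →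
      F (z, star z, (s : ℂ)) = 0) :
    ∀ v ∈ ball (0 : ℂ × ℂ × ℂ) ρ, F v = 0 := by
  rintro ⟨z, χ, s⟩ hv
  set x : ℂ × ℂ × ℂ := ((z + star χ) / 2, star ((z + star χ) / 2), ((s.re : ℝ) : ℂ)) with hx
  set y : ℂ × ℂ × ℂ := ((z - star χ) / (2 * I), star ((z - star χ) / (2 * I)), ((s.im : ℝ) : ℂ)) with hy
  have hxy : x + I • y = (z, χ, s) := by
    ext1
    · simp [hx, hy]; field_simp; ring
    ext1
    · simp [hx, hy]; field_simp; ring_nf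
    · simp [hx, hy]; rw [mul_comm]; exact Complex.re_add_im s
  have hz : ‖z‖ < ρ ∧ ‖χ‖ < ρ ∧ ‖s‖ < ρ := by
    simpa [Prod.norm_def] using hv
  have hxb : x ∈ ball (0 : ℂ × ℂ × ℂ) ρ := by
    have h1 : ‖(z + star χ) / 2‖ < ρ := by
      rw [norm_div]
      have := norm_add_le z (star χ)
      rw [norm_star] at this
      simp only [Complex.norm_ofNat]
      linarith [hz.1, hz.2.1]
    have h2 : ‖((s.re : ℝ) : ℂ)‖ < ρ := by
      rw [Complex.norm_real]; exact (Complex.abs_re_le_norm s).trans_lt hz.2.2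
    rw [mem_ball_zero_iff, Prod.norm_def, Prod.norm_def]
    simp only [hx, norm_star, max_lt_iff]
    exact ⟨h1, h1, h2⟩
  let L : ℂ → ℂ × ℂ × ℂ := fun t => x + t • y
  have hL : Differentiable ℂ L := by fun_prop
  have hreal : ∀ t : ℝ, L t ∈ ball (0 : ℂ × ℂ × ℂ) ρ → F (L t) = 0 := by
    intro t ht
    have e : L t = ((z + star χ) / 2 + t * ((z - star χ) / (2 * I)),
        star ((z + star χ) / 2 + t * ((z - star χ) / (2 * I))), ((s.re + t * s.im : ℝ) : ℂ)) := by
      simp [L, hx, hy]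
    rw [e] at ht ⊢
    exact h0 _ _ ht
  have hDo : IsOpen (L ⁻¹' ball 0 ρ) := isOpen_ball.preimage hL.continuous
  have hDc : IsPreconnected (L ⁻¹' ball (0 : ℂ × ℂ × ℂ) ρ) := by
    refine Convex.isPreconnected ?_
    intro a ha b hb p q hp hq hpq
    have : L (p • a + q • b) = p • L a + q • L b := by
      simp only [L, smul_add, add_smul, smul_assoc]
      have : x = p • x + q • x := by rw [← add_smul, hpq, one_smul]
      nth_rewrite 1 [this]
      abel
    rw [Set.mem_preimage, this]
    exact convex_ball (0 : ℂ × ℂ × ℂ) ρ ha hb hp hq hpq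
  have hg : AnalyticOnNhd ℂ (fun t => F (L t)) (L ⁻¹' ball 0 ρ) := by
    refine DifferentiableOn.analyticOnNhd ?_ hDo
    exact hF.comp hL.differentiableOn (fun t ht => ht)
  have h0D : (0 : ℂ) ∈ L ⁻¹' ball (0 : ℂ × ℂ × ℂ) ρ := by simpa [L] using hxb
  have hfreq : ∃ᶠ t in 𝓝[≠] (0 : ℂ), F (L t) = 0 := by
    have ht : Tendsto (fun t : ℝ => (t : ℂ)) (𝓝[≠] 0) (𝓝[≠] 0) := by
      refine tendsto_nhdsWithin_iff.2 ⟨?_, ?_⟩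
      · have : Tendsto (fun t : ℝ => (t : ℂ)) (𝓝 0) (𝓝 ((0 : ℝ) : ℂ)) :=
          Complex.continuous_ofReal.tendsto 0
        simpa using this.mono_left nhdsWithin_le_nhds
      · filter_upwards [self_mem_nhdsWithin] with t ht
        simpa using ht
    refine ht.frequently (Eventually.frequently ?_)
    have := (ht.mono_right nhdsWithin_le_nhds).eventually (hDo.mem_nhds h0D)
    filter_upwards [this] with t ht
    exact hreal t ht
  have := hg.eqOn_zero_of_preconnected_of_frequently_eq_zero hDc h0D hfreq
    (show I ∈ L ⁻¹' ball 0 ρ by rw [Set.mem_preimage]; simp only [L]; rw [hxy]; exact hv)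
  simpa [L, hxy] using this

section wirt

variable {E G : Type*} [NormedAddCommGroup E] [NormedSpace ℂ E]
    [StarAddMonoid E] [StarModule ℂ E] [NormedStarGroup E]
    [NormedAddCommGroup G] [NormedSpace ℂ G]

theorem wir_hasFDerivAt {f : E → G} {R : E × E → G} {p : E}
    (hR : DifferentiableAt ℂ R (p, star p)) (hf : f =ᶠ[𝓝 p] fun q => R (q, star q)) :
    HasFDerivAt f (((fderiv ℂ R (p, star p)).restrictScalars ℝ).comp
      ((ContinuousLinearMap.id ℝ E).prod (starL' ℝ : E ≃L[ℝ] E).toContinuousLinearMap)) p := by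
  have h1 : HasFDerivAt (fun q : E => (q, star q))
      ((ContinuousLinearMap.id ℝ E).prod (starL' ℝ : E ≃L[ℝ] E).toContinuousLinearMap) p :=
    (hasFDerivAt_id p).prodMk (starL' ℝ : E ≃L[ℝ] E).hasFDerivAt
  have h2 := (hR.hasFDerivAt.restrictScalars ℝ)
  exact (HasFDerivAt.comp (𝕜 := ℝ) p h2 h1).congr_of_eventuallyEq hf

theorem wir_fderiv {f : E → G} {R : E × E → G} {p : E}
    (hR : DifferentiableAt ℂ R (p, star p)) (hf : f =ᶠ[𝓝 p] fun q => R (q, star q)) (v : E) :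
    fderiv ℝ f p v = fderiv ℂ R (p, star p) (v, star v) := by
  rw [(wir_hasFDerivAt hR hf).fderiv]; rfl

theorem wir_wDer {f : E → G} {R : E × E → G} {p : E}
    (hR : DifferentiableAt ℂ R (p, star p)) (hf : f =ᶠ[𝓝 p] fun q => R (q, star q)) (v : E) :
    wDer v f p = fderiv ℂ R (p, star p) (v, 0) := by
  rw [wDer, wir_fderiv hR hf, wir_fderiv hR hf, ← map_smul, ← map_sub, ← map_smul]
  congr 1
  simp only [Prod.smul_mk, Prod.mk_sub_mk, star_smul, smul_smul]
  ext1
  · simp only [I_mul_I, neg_smul, one_smul, sub_neg_eq_add, ← two_smul ℂ v, smul_smul]; simp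
  · simp

theorem wir_wDerBar {f : E → G} {R : E × E → G} {p : E}
    (hR : DifferentiableAt ℂ R (p, star p)) (hf : f =ᶠ[𝓝 p] fun q => R (q, star q)) (v : E) :
    wDerBar v f p = fderiv ℂ R (p, star p) (0, star v) := by
  rw [wDerBar, wir_fderiv hR hf, wir_fderiv hR hf, ← map_smul, ← map_add, ← map_smul]
  congr 1
  simp only [Prod.smul_mk, Prod.mk_add_mk, star_smul, smul_smul]
  ext1
  · simp
  · simp only [Complex.star_def, conj_I, mul_neg, I_mul_I, neg_neg, one_smul,
      ← two_smul ℂ (star v), smul_smul]; simp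

end wirt
theorem half_add_conj (x : ℂ) : 2⁻¹ * x + 2⁻¹ * (starRingEnd ℂ) x = ((x.re : ℝ) : ℂ) := by
  rw [← mul_add, Complex.add_conj]; push_cast; ring

theorem exP (φ : ℂ × ℝ → ℝ) (hφa : AnalyticAt ℝ φ 0) :
    ∃ P : ℂ × ℂ × ℂ → ℂ, AnalyticAt ℂ P 0 ∧
      ∀ᶠ x in 𝓝 (0 : ℂ × ℝ), P (x.1, star x.1, (x.2 : ℂ)) = (φ x : ℂ) := by
  let f1 := ContinuousLinearMap.fst ℂ ℂ (ℂ × ℂ)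
  let f2 := (ContinuousLinearMap.fst ℂ ℂ ℂ).comp (ContinuousLinearMap.snd ℂ ℂ (ℂ × ℂ))
  let f3 := (ContinuousLinearMap.snd ℂ ℂ ℂ).comp (ContinuousLinearMap.snd ℂ ℂ (ℂ × ℂ))
  refine cx_exists (ι := Fin 3) ![((1 : ℂ), (0 : ℝ)), (I, 0), (0, 1)]
    ![(2⁻¹ : ℂ) • (f1 + f2), (2 * I)⁻¹ • (f1 - f2), f3]
    (fun x => (x.1, star x.1, (x.2 : ℂ))) (fun x => ![x.1.re, x.1.im, x.2]) ?_ ?_ φ hφa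
  · intro x i
    fin_cases i
    · simp [f1, f2]; exact half_add_conj _
    · simp [f1, f2, Complex.sub_conj]; field_simp; simp
    · simp [f3]
  · intro x
    rw [Fin.sum_univ_three]
    ext1
    · apply Complex.ext <;> simp
    · simp

theorem exR (ρ' : ℂ × ℂ × ℂ → ℝ) (h : AnalyticAt ℝ ρ' 0) :
    ∃ R : (ℂ × ℂ × ℂ) × (ℂ × ℂ × ℂ) → ℂ, AnalyticAt ℂ R 0 ∧
      ∀ᶠ q in 𝓝 (0 : ℂ × ℂ × ℂ), R (q, star q) = (ρ' q : ℂ) := by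
  let f1 := ContinuousLinearMap.fst ℂ ℂ (ℂ × ℂ)
  let f2 := (ContinuousLinearMap.fst ℂ ℂ ℂ).comp (ContinuousLinearMap.snd ℂ ℂ (ℂ × ℂ))
  let f3 := (ContinuousLinearMap.snd ℂ ℂ ℂ).comp (ContinuousLinearMap.snd ℂ ℂ (ℂ × ℂ))
  let A := ContinuousLinearMap.fst ℂ (ℂ × ℂ × ℂ) (ℂ × ℂ × ℂ)
  let B := ContinuousLinearMap.snd ℂ (ℂ × ℂ × ℂ) (ℂ × ℂ × ℂ)
  refine cx_exists (ι := Fin 6) ![((1 : ℂ), (0 : ℂ), (0 : ℂ)), (I, 0, 0), (0, 1, 0), (0, I, 0),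
      (0, 0, 1), (0, 0, I)]
    ![(2⁻¹ : ℂ) • (f1.comp A + f1.comp B), (2 * I)⁻¹ • (f1.comp A - f1.comp B),
      (2⁻¹ : ℂ) • (f2.comp A + f2.comp B), (2 * I)⁻¹ • (f2.comp A - f2.comp B),
      (2⁻¹ : ℂ) • (f3.comp A + f3.comp B), (2 * I)⁻¹ • (f3.comp A - f3.comp B)]
    (fun x => (x, star x)) (fun x => ![x.1.re, x.1.im, x.2.1.re, x.2.1.im, x.2.2.re, x.2.2.im])
    ?_ ?_ ρ' h
  · intro x i
    fin_cases i
    · simp [f1, A, B]; exact half_add_conj _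
    · simp [f1, A, B, Complex.sub_conj]; field_simp; simp
    · simp [f2, A, B]; exact half_add_conj _
    · simp [f2, A, B, Complex.sub_conj]; field_simp; simp
    · simp [f3, A, B]; exact half_add_conj _
    · simp [f3, A, B, Complex.sub_conj]; field_simp; simp
  · intro x
    rw [Fin.sum_univ_six]
    ext1
    · apply Complex.ext <;> simp
    ext1
    · apply Complex.ext <;> simp
    · apply Complex.ext <;> simp

/-- The totally real embedding `(z,s) ↦ (z, z̄, s)`. -/
noncomputable def J3 : (ℂ × ℝ) →L[ℝ] ℂ × ℂ × ℂ :=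
  (ContinuousLinearMap.fst ℝ ℂ ℝ).prod
    (((starL' ℝ : ℂ ≃L[ℝ] ℂ).toContinuousLinearMap.comp (ContinuousLinearMap.fst ℝ ℂ ℝ)).prod
      (Complex.ofRealCLM.comp (ContinuousLinearMap.snd ℝ ℂ ℝ)))

theorem J3_apply (x : ℂ × ℝ) : J3 x = (x.1, star x.1, (x.2 : ℂ)) := rfl

theorem j3_fderiv {f : ℂ × ℝ → ℂ} {Q : ℂ × ℂ × ℂ → ℂ} {p : ℂ × ℝ}
    (hQ : DifferentiableAt ℂ Q (J3 p)) (hf : f =ᶠ[𝓝 p] fun q => Q (J3 q)) (v : ℂ × ℝ) :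
    fderiv ℝ f p v = fderiv ℂ Q (J3 p) (J3 v) := by
  have h2 := (hQ.hasFDerivAt.restrictScalars ℝ)
  rw [((HasFDerivAt.comp (𝕜 := ℝ) p h2 J3.hasFDerivAt).congr_of_eventuallyEq hf).fderiv]
  rfl

theorem j3_wzPhi {f : ℂ × ℝ → ℂ} {Q : ℂ × ℂ × ℂ → ℂ} {p : ℂ × ℝ}
    (hQ : DifferentiableAt ℂ Q (J3 p)) (hf : f =ᶠ[𝓝 p] fun q => Q (J3 q)) :
    wzPhi f p = fderiv ℂ Q (J3 p) (1, 0, 0) := by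
  rw [wzPhi, j3_fderiv hQ hf, j3_fderiv hQ hf, ← smul_eq_mul, ← smul_eq_mul (a := I),
    ← map_smul, ← map_sub, ← map_smul]
  congr 1
  simp [J3_apply]
  exact ⟨by ring, rfl⟩

theorem j3_wzBarPhi {f : ℂ × ℝ → ℂ} {Q : ℂ × ℂ × ℂ → ℂ} {p : ℂ × ℝ}
    (hQ : DifferentiableAt ℂ Q (J3 p)) (hf : f =ᶠ[𝓝 p] fun q => Q (J3 q)) :
    wzBarPhi f p = fderiv ℂ Q (J3 p) (0, 1, 0) := by
  rw [wzBarPhi, j3_fderiv hQ hf, j3_fderiv hQ hf, ← smul_eq_mul, ← smul_eq_mul (a := I),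
    ← map_smul, ← map_add, ← map_smul]
  congr 1
  simp [J3_apply]
  ring

section phi
variable {φ : ℂ × ℝ → ℝ} {P : ℂ × ℂ × ℂ → ℂ}

theorem P_zero (hφ0 : φ 0 = 0)
    (hP2 : ∀ᶠ x in 𝓝 (0 : ℂ × ℝ), P (x.1, star x.1, (x.2 : ℂ)) = (φ x : ℂ)) : P 0 = 0 := by
  have := hP2.self_of_nhds
  have h2 : P (0, 0, 0) = 0 := by simpa [hφ0] using this
  exact h2

theorem P_fderiv (hφa : AnalyticAt ℝ φ 0) (hφ1 : fderiv ℝ φ 0 = 0) (hP : AnalyticAt ℂ P 0)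
    (hP2 : ∀ᶠ x in 𝓝 (0 : ℂ × ℝ), P (x.1, star x.1, (x.2 : ℂ)) = (φ x : ℂ)) :
    fderiv ℂ P 0 = 0 := by
  have h1 : ∀ v, fderiv ℂ P 0 (J3 v) = 0 := by
    intro v
    have h2 := j3_fderiv (f := fun x => (φ x : ℂ)) (Q := P) (p := 0)
      (by simpa using hP.differentiableAt) (by
        filter_upwards [hP2] with x hx
        exact hx.symm) v
    rw [map_zero] at h2
    rw [← h2]
    have h3 : HasFDerivAt φ (0 : (ℂ × ℝ) →L[ℝ] ℝ) 0 := by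
      rw [← hφ1]; exact hφa.differentiableAt.hasFDerivAt
    have h4 := Complex.ofRealCLM.hasFDerivAt.comp (0 : ℂ × ℝ) h3
    have h5 : HasFDerivAt (fun x => (φ x : ℂ)) (Complex.ofRealCLM.comp (0 : (ℂ × ℝ) →L[ℝ] ℝ)) 0 := h4
    rw [h5.fderiv]; simp
  ext
  · have e1 := h1 (1, 0)
    have e2 := h1 (I, 0)
    have e : ((1 : ℂ), (0 : ℂ), (0 : ℂ)) = (2⁻¹ : ℂ) • (J3 (1, 0) - I • J3 (I, 0)) := by
      simp [J3_apply]; ring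
    simp only [ContinuousLinearMap.comp_apply, ContinuousLinearMap.inl_apply]
    change fderiv ℂ P 0 ((1 : ℂ), (0 : ℂ), (0 : ℂ)) = 0
    rw [e, map_smul, map_sub, map_smul, e1, e2]; simp
  · have e1 := h1 (1, 0)
    have e2 := h1 (I, 0)
    have e : ((0 : ℂ), (1 : ℂ), (0 : ℂ)) = (2⁻¹ : ℂ) • (J3 (1, 0) + I • J3 (I, 0)) := by
      simp [J3_apply]; ring
    change fderiv ℂ P 0 ((0 : ℂ), (1 : ℂ), (0 : ℂ)) = 0
    rw [e, map_smul, map_add, map_smul, e1, e2]; simp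
  · have e1 := h1 (0, 1)
    simpa [J3_apply] using e1

theorem P_quad (hφa : AnalyticAt ℝ φ 0) (hφ0 : φ 0 = 0) (hφ1 : fderiv ℝ φ 0 = 0)
    (hP : AnalyticAt ℂ P 0)
    (hP2 : ∀ᶠ x in 𝓝 (0 : ℂ × ℝ), P (x.1, star x.1, (x.2 : ℂ)) = (φ x : ℂ))
    (hφspc : ∃ cℓ : ℝ, 0 < cℓ
      ∧ wzPhi (fun p => wzBarPhi (fun q => ((φ q : ℝ) : ℂ)) p) 0 = (cℓ : ℂ)) :
    ∃ a b : ℂ, b ≠ 0 ∧ (fun p : ℂ × ℂ => P (p.1, p.2, 0) -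
      (a * p.1 ^ 2 + b * p.1 * p.2 + star a * p.2 ^ 2)) =O[𝓝 0] (fun p => ‖p‖ ^ 3) := by
  set D := fderiv ℂ (fderiv ℂ P) 0 with hD
  have hsymm : ∀ u v, D u v = D v u := by
    intro u v
    exact (hP.contDiffAt (n := 2)).isSymmSndFDerivAt (by simp) u v
  -- Levi form
  have hb : D (1, 0, 0) (0, 1, 0) ≠ 0 := by
    obtain ⟨c, hc0, hc⟩ := hφspc
    have h1 : (fun p => wzBarPhi (fun q => ((φ q : ℝ) : ℂ)) p) =ᶠ[𝓝 0]
        fun p => (fun y => fderiv ℂ P y (0, 1, 0)) (J3 p) := by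
      have hJ : Tendsto J3 (𝓝 0) (𝓝 0) := by simpa using J3.continuous.tendsto 0
      filter_upwards [hP2.eventually_nhds, hJ.eventually hP.eventually_analyticAt] with p hp1 hp2
      refine j3_wzBarPhi hp2.differentiableAt ?_
      filter_upwards [hp1] with x hx
      exact hx.symm
    have h2 := an_clm_apply hP.fderiv ((0 : ℂ), (1 : ℂ), (0 : ℂ))
    rw [j3_wzPhi (by simpa using h2.differentiableAt) h1, map_zero] at hc
    have h3 : HasFDerivAt (fun y => fderiv ℂ P y (0, 1, 0))
      ((ContinuousLinearMap.apply ℂ ℂ ((0 : ℂ), (1 : ℂ), (0 : ℂ))).comp D) 0 :=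
      (ContinuousLinearMap.apply ℂ ℂ ((0 : ℂ), (1 : ℂ), (0 : ℂ))).hasFDerivAt.comp 0
        hP.fderiv.differentiableAt.hasFDerivAt
    rw [h3.fderiv] at hc
    have : D (1, 0, 0) (0, 1, 0) = (c : ℂ) := hc
    rw [this]
    exact_mod_cast hc0.ne'
  set b := D (1, 0, 0) (0, 1, 0) with hbdef
  set a := (2⁻¹ : ℂ) * D (1, 0, 0) (1, 0, 0) with ha
  set d := (2⁻¹ : ℂ) * D (0, 1, 0) (0, 1, 0) with hd
  have hquad : (fun p : ℂ × ℂ => P (p.1, p.2, 0) -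
      (a * p.1 ^ 2 + b * p.1 * p.2 + d * p.2 ^ 2)) =O[𝓝 0] (fun p => ‖p‖ ^ 3) := by
    obtain ⟨q, hq⟩ := hP
    have h1 := hq.isBigO_sub_partialSum_pow 3
    have hι : Tendsto (fun p : ℂ × ℂ => ((p.1, p.2, 0) : ℂ × ℂ × ℂ)) (𝓝 0) (𝓝 0) := by
      have : Continuous (fun p : ℂ × ℂ => ((p.1, p.2, 0) : ℂ × ℂ × ℂ)) := by fun_prop
      exact this.tendsto 0
    have h2 := h1.comp_tendsto hι
    refine (h2.congr ?_ ?_)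
    · intro p
      simp only [Function.comp, zero_add, FormalMultilinearSeries.partialSum, Finset.sum_range_succ,
        Finset.sum_range_zero]
      have e0 : q 0 (fun _ : Fin 0 => ((p.1, p.2, 0) : ℂ × ℂ × ℂ)) = 0 := by
        rw [hq.coeff_zero, P_zero hφ0 hP2]
      have e1 : q 1 (fun _ : Fin 1 => ((p.1, p.2, 0) : ℂ × ℂ × ℂ)) = 0 := by
        have := hq.hasFDerivAt.fderiv
        rw [P_fderiv hφa hφ1 ⟨q, hq⟩ hP2] at this
        have h3 := congrArg (fun T => T ((p.1, p.2, 0) : ℂ × ℂ × ℂ)) this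
        simp only [continuousMultilinearCurryFin1_apply] at h3
        rw [show (fun _ : Fin 1 => ((p.1, p.2, 0) : ℂ × ℂ × ℂ)) =
          Fin.snoc 0 ((p.1, p.2, 0) : ℂ × ℂ × ℂ) by ext1 i; fin_cases i; rfl]
        exact h3.symm
      have e2 : q 2 (fun _ : Fin 2 => ((p.1, p.2, 0) : ℂ × ℂ × ℂ)) =
          a * p.1 ^ 2 + b * p.1 * p.2 + d * p.2 ^ 2 := by
        obtain ⟨r, hr⟩ := hq
        have h3 := hr.factorial_smul ((p.1, p.2, 0) : ℂ × ℂ × ℂ) 2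
        rw [iteratedFDeriv_two_apply] at h3
        have e : ((p.1, p.2, 0) : ℂ × ℂ × ℂ) = p.1 • ((1 : ℂ), (0 : ℂ), (0 : ℂ))
          + p.2 • ((0 : ℂ), (1 : ℂ), (0 : ℂ)) := by simp
        have h4 : D ((p.1, p.2, 0) : ℂ × ℂ × ℂ) ((p.1, p.2, 0) : ℂ × ℂ × ℂ) =
            2 * (a * p.1 ^ 2 + b * p.1 * p.2 + d * p.2 ^ 2) := by
          rw [e]
          simp only [map_add, map_smul, _root_.add_apply,
            _root_.smul_apply, smul_eq_mul]
          rw [hsymm (0, 1, 0) (1, 0, 0)]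
          simp only [ha, hd, hbdef]
          ring
        rw [h4] at h3
        simp at h3
        linear_combination h3
      rw [e0, e1, e2]; ring
    · intro p
      simp only [Function.comp]
      congr 1
      simp [Prod.norm_def]
  -- reality
  have hre : ∀ z : ℂ, (a * z ^ 2 + b * z * star z + d * star z ^ 2).im = 0 := by
    intro z
    obtain ⟨C, hC⟩ := hquad.bound
    have ht : Tendsto (fun t : ℝ => (((t : ℂ) * z, (t : ℂ) * star z) : ℂ × ℂ)) (𝓝[>] 0) (𝓝 0) := by
      have : Continuous (fun t : ℝ => (((t : ℂ) * z, (t : ℂ) * star z) : ℂ × ℂ)) := by fun_prop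
      have h := this.tendsto 0
      simp only [ofReal_zero, zero_mul] at h
      exact h.mono_left nhdsWithin_le_nhds
    have ht2 : Tendsto (fun t : ℝ => (((t : ℂ) * z, (0 : ℝ)) : ℂ × ℝ)) (𝓝[>] 0) (𝓝 0) := by
      have : Continuous (fun t : ℝ => (((t : ℂ) * z, (0 : ℝ)) : ℂ × ℝ)) := by fun_prop
      have h := this.tendsto 0
      simp only [ofReal_zero, zero_mul] at h
      exact h.mono_left nhdsWithin_le_nhds
    have hev : ∀ᶠ t : ℝ in 𝓝[>] 0, |(a * z ^ 2 + b * z * star z + d * star z ^ 2).im| ≤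
        C * ‖z‖ ^ 3 * t := by
      filter_upwards [ht.eventually hC, ht2.eventually hP2, self_mem_nhdsWithin] with t h1 h2 h3
      have h3' : (0 : ℝ) < t := h3
      have e : star ((t : ℂ) * z) = (t : ℂ) * star z := by simp
      simp only [e, ofReal_zero] at h2
      simp only [h2] at h1
      have h4 := (Complex.abs_im_le_norm _).trans h1
      have e5 : (a * ((t : ℂ) * z) ^ 2 + b * ((t : ℂ) * z) * ((t : ℂ) * star z)
        + d * ((t : ℂ) * star z) ^ 2) = ((t ^ 2 : ℝ) : ℂ) *
          (a * z ^ 2 + b * z * star z + d * star z ^ 2) := by push_cast; ring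
      rw [e5, Complex.sub_im, Complex.ofReal_im, zero_sub, abs_neg, Complex.im_ofReal_mul, abs_mul,
        abs_of_nonneg (by positivity)] at h4
      have e6 : ‖(((t : ℂ) * z, (t : ℂ) * star z) : ℂ × ℂ)‖ = t * ‖z‖ := by
        simp [Prod.norm_def, abs_of_pos h3']
      rw [e6, Real.norm_of_nonneg (by positivity)] at h4
      have h7 : t ^ 2 * |(a * z ^ 2 + b * z * star z + d * star z ^ 2).im| ≤
        t ^ 2 * (C * ‖z‖ ^ 3 * t) := h4.trans (le_of_eq (by ring))
      exact le_of_mul_le_mul_left h7 (by positivity)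
    have hlim : Tendsto (fun t : ℝ => C * ‖z‖ ^ 3 * t) (𝓝[>] 0) (𝓝 0) := by
      have : Continuous (fun t : ℝ => C * ‖z‖ ^ 3 * t) := by fun_prop
      have h := this.tendsto 0
      rw [mul_zero] at h
      exact h.mono_left nhdsWithin_le_nhds
    have := ge_of_tendsto hlim hev
    exact abs_nonpos_iff.1 this
  have hda : d = star a := by
    have h1 := hre 1
    have h2 := hre I
    have h3 := hre (1 + I)
    simp [pow_two] at h1 h2 h3
    apply Complex.ext <;> simp <;> linarith
  rw [hda] at hquad
  exact ⟨a, b, hb, hquad⟩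

end phi

theorem exSigma {P : ℂ × ℂ × ℂ → ℂ} (hP : AnalyticAt ℂ P 0) (hP0 : P 0 = 0)
    (hP1 : fderiv ℂ P 0 = 0) :
    ∃ σ : ℂ × ℂ × ℂ → ℂ, AnalyticAt ℂ σ 0 ∧ σ 0 = 0 ∧
      ∀ᶠ y in 𝓝 (0 : ℂ × ℂ × ℂ), y.2.2 = σ y + I * P (y.1, y.2.1, σ y) := by
  let Θ : ℂ × ℂ × ℂ → ℂ × ℂ × ℂ := fun y => (y.1, y.2.1, y.2.2 + I * P y)
  have hΘa : AnalyticAt ℂ Θ 0 := by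
    refine analyticAt_fst.prod ((analyticAt_fst.comp analyticAt_snd).prod
      ((analyticAt_snd.comp analyticAt_snd).add (analyticAt_const.mul hP)))
  have hΘ0 : Θ 0 = 0 := by simp [Θ, hP0]
  have hP' : HasStrictFDerivAt P (0 : ℂ × ℂ × ℂ →L[ℂ] ℂ) 0 := by
    have := hP.hasStrictFDerivAt
    rwa [hP1] at this
  have hd : HasStrictFDerivAt Θ
      ((ContinuousLinearEquiv.refl ℂ (ℂ × ℂ × ℂ)) : ℂ × ℂ × ℂ →L[ℂ] ℂ × ℂ × ℂ) 0 := by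
    have h1 := (hasStrictFDerivAt_fst (𝕜 := ℂ) (p := (0 : ℂ × ℂ × ℂ))).prodMk
      (((hasStrictFDerivAt_fst (𝕜 := ℂ)).comp (0 : ℂ × ℂ × ℂ) hasStrictFDerivAt_snd).prodMk
      (((hasStrictFDerivAt_snd (𝕜 := ℂ)).comp (0 : ℂ × ℂ × ℂ) hasStrictFDerivAt_snd).add
        (hP'.const_mul I)))
    refine h1.congr_fderiv ?_
    ext <;> simp
  set Φ := hd.toOpenPartialHomeomorph Θ with hΦ
  have hsrc : (0 : ℂ × ℂ × ℂ) ∈ Φ.source := hd.mem_toOpenPartialHomeomorph_source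
  have hsymm : AnalyticAt ℂ Φ.symm 0 := by
    have := Φ.analyticAt_symm' (i := ContinuousLinearEquiv.refl ℂ (ℂ × ℂ × ℂ)) hsrc hΘa
      hd.hasFDerivAt.fderiv
    have e : Φ 0 = 0 := hΘ0
    rwa [e] at this
  have hs0 : Φ.symm 0 = 0 := by
    have := Φ.left_inv hsrc
    have e : Φ 0 = 0 := hΘ0
    rwa [e] at this
  refine ⟨fun y => (Φ.symm y).2.2, (analyticAt_snd.comp analyticAt_snd).comp hsymm, by simp [hs0], ?_⟩
  have ht : (0 : ℂ × ℂ × ℂ) ∈ Φ.target := by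
    have := Φ.map_source hsrc
    have e : Φ 0 = 0 := hΘ0
    rwa [e] at this
  filter_upwards [Φ.open_target.mem_nhds ht] with y hy
  have h1 : Θ (Φ.symm y) = y := Φ.right_inv hy
  have h2 := congrArg Prod.fst h1
  have h3 := congrArg (fun q : ℂ × ℂ × ℂ => q.2.1) h1
  have h4 := congrArg (fun q : ℂ × ℂ × ℂ => q.2.2) h1
  simp only [Θ] at h2 h3 h4
  rw [← h2, ← h3, ← h4]

theorem star_mem_ball {x : ℂ × ℂ} {r : ℝ} : star x ∈ ball (0 : ℂ × ℂ) r ↔ x ∈ ball (0 : ℂ × ℂ) r := by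
  simp

theorem reflect {φ : ℂ × ℝ → ℝ} {P : ℂ × ℂ × ℂ → ℂ} (hP : AnalyticAt ℂ P 0) (hP0 : P 0 = 0)
    (hP2 : ∀ᶠ x in 𝓝 (0 : ℂ × ℝ), P (x.1, star x.1, (x.2 : ℂ)) = (φ x : ℂ))
    {σ : ℂ × ℂ × ℂ → ℂ} (hσ : AnalyticAt ℂ σ 0) (hσ0 : σ 0 = 0)
    (hσe : ∀ᶠ y in 𝓝 (0 : ℂ × ℂ × ℂ), y.2.2 = σ y + I * P (y.1, y.2.1, σ y))
    {ρ' : ℂ × ℂ × ℂ → ℝ} {R : (ℂ × ℂ × ℂ) × (ℂ × ℂ × ℂ) → ℂ} (hR : AnalyticAt ℂ R 0)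
    (hR2 : ∀ᶠ q in 𝓝 (0 : ℂ × ℂ × ℂ), R (q, star q) = (ρ' q : ℂ))
    {H : ℂ × ℂ → ℂ × ℂ × ℂ} (hHa : AnalyticAt ℂ H 0) (hH0 : H 0 = 0)
    (hHm : ∀ᶠ p in 𝓝 (0 : ℂ × ℂ), p ∈ Mset φ → ρ' (H p) = 0) :
    ∃ r > (0 : ℝ), ∃ δ > (0 : ℝ), ∃ ρ1 > (0 : ℝ),
      AnalyticOnNhd ℂ H (ball 0 r) ∧ (∀ p ∈ Mset φ ∩ ball 0 r, ρ' (H p) = 0) ∧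
      (∀ p ∈ ball (0 : ℂ × ℂ) r, ∀ q ∈ ball (0 : ℂ × ℂ) r, AnalyticAt ℂ R (H p, star (H q))) ∧
      (∀ p ∈ ball (0 : ℂ × ℂ) r, ∀ᶠ q in 𝓝 (H p), R (q, star q) = (ρ' q : ℂ)) ∧
      (∀ y ∈ ball (0 : ℂ × ℂ × ℂ) ρ1, AnalyticAt ℂ σ y ∧ (y.1, y.2.2) ∈ ball (0 : ℂ × ℂ) r ∧
        (y.2.1, 2 * σ y - y.2.2) ∈ ball (0 : ℂ × ℂ) r) ∧
      ∀ Hh : ℂ × ℂ → ℂ × ℂ × ℂ, AnalyticOnNhd ℂ Hh (ball 0 r) →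
        (∀ p ∈ Mset φ ∩ ball 0 r, ρ' (Hh p) = 0) →
        (∀ p ∈ ball 0 r, ‖Hh p - H p‖ < δ) →
        ∀ y ∈ ball (0 : ℂ × ℂ × ℂ) ρ1,
          R (Hh (y.1, y.2.2), star (Hh (star (y.2.1, 2 * σ y - y.2.2)))) = 0 := by
  obtain ⟨ρR, hρR, hρR1⟩ : ∃ ρR > (0 : ℝ), ∀ q ∈ ball (0 : (ℂ × ℂ × ℂ) × (ℂ × ℂ × ℂ)) ρR,
      AnalyticAt ℂ R q := Metric.eventually_nhds_iff_ball.1 hR.eventually_analyticAt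
  obtain ⟨ρR', hρR', hρR1'⟩ := Metric.eventually_nhds_iff_ball.1 hR2.eventually_nhds
  set ρq := min ρR ρR' with hρq
  have hρq0 : 0 < ρq := lt_min hρR hρR'
  have hRan : ∀ q q' : ℂ × ℂ × ℂ, ‖q‖ < ρq → ‖q'‖ < ρq → AnalyticAt ℂ R (q, star q') := by
    intro q q' h1 h2
    apply hρR1
    rw [mem_ball_zero_iff, Prod.norm_def]
    simp only [norm_star]
    exact max_lt (h1.trans_le (min_le_left _ _)) (h2.trans_le (min_le_left _ _))
  have hReq : ∀ q : ℂ × ℂ × ℂ, ‖q‖ < ρq → ∀ᶠ q in 𝓝 q, R (q, star q) = (ρ' q : ℂ) := by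
    intro q h1
    apply hρR1'
    rw [mem_ball_zero_iff]
    exact h1.trans_le (min_le_right _ _)
  have hHs : ∀ᶠ p in 𝓝 (0 : ℂ × ℂ), ‖H p‖ < ρq / 2 := by
    have h1 := hHa.continuousAt.norm
    have h2 : Tendsto (fun p => ‖H p‖) (𝓝 0) (𝓝 0) := by
      have := h1.tendsto
      simpa [hH0] using this
    exact h2.eventually_lt_const (by positivity)
  obtain ⟨r, hr, hr1⟩ := Metric.eventually_nhds_iff_ball.1
    (hHs.and (hHa.eventually_analyticAt.and hHm))
  have hp1 : ContinuousAt (fun y : ℂ × ℂ × ℂ => (y.1, y.2.2 + I * P y)) 0 := by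
    have := hP.continuousAt
    fun_prop
  have hp2 : ContinuousAt (fun y : ℂ × ℂ × ℂ => (y.2.1, y.2.2 - I * P y)) 0 := by
    have := hP.continuousAt
    fun_prop
  have hp1' : ∀ᶠ y in 𝓝 (0 : ℂ × ℂ × ℂ), (y.1, y.2.2 + I * P y) ∈ ball (0 : ℂ × ℂ) r := by
    refine hp1.tendsto.eventually (isOpen_ball.mem_nhds ?_)
    simp [hP0, hr]
  have hp2' : ∀ᶠ y in 𝓝 (0 : ℂ × ℂ × ℂ), (y.2.1, y.2.2 - I * P y) ∈ ball (0 : ℂ × ℂ) r := by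
    refine hp2.tendsto.eventually (isOpen_ball.mem_nhds ?_)
    simp [hP0, hr]
  obtain ⟨ρ3, hρ3, h3⟩ := Metric.eventually_nhds_iff_ball.1 hP2
  obtain ⟨ρ4, hρ4, h4⟩ := Metric.eventually_nhds_iff_ball.1
    (hp1'.and (hp2'.and hP.eventually_analyticAt))
  set ρ0 := min ρ3 ρ4 with hρ0
  have hρ00 : 0 < ρ0 := lt_min hρ3 hρ4
  have hσc : ∀ᶠ y in 𝓝 (0 : ℂ × ℂ × ℂ), (y.1, y.2.1, σ y) ∈ ball (0 : ℂ × ℂ × ℂ) ρ0 := by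
    have h1 : ContinuousAt (fun y : ℂ × ℂ × ℂ => (y.1, y.2.1, σ y)) 0 := by
      have := hσ.continuousAt
      fun_prop
    refine h1.tendsto.eventually (isOpen_ball.mem_nhds ?_)
    simp [hσ0, hρ00]
  obtain ⟨ρ1, hρ1, h5⟩ := Metric.eventually_nhds_iff_ball.1
    (hσc.and (hσ.eventually_analyticAt.and hσe))
  have key : ∀ y ∈ ball (0 : ℂ × ℂ × ℂ) ρ1,
      σ y + I * P (y.1, y.2.1, σ y) = y.2.2 ∧ σ y - I * P (y.1, y.2.1, σ y) = 2 * σ y - y.2.2 := by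
    intro y hy
    have := (h5 y hy).2.2
    constructor
    · exact this.symm
    · linear_combination this
  refine ⟨r, hr, ρq / 2, by positivity, ρ1, hρ1, fun p hp => (hr1 p hp).2.1,
    fun p hp => (hr1 p hp.2).2.2 hp.1, fun p hp q hq => hRan _ _ ?_ ?_, fun p hp => hReq _ ?_,
    fun y hy => ⟨(h5 y hy).2.1, ?_, ?_⟩, ?_⟩
  · exact (hr1 p hp).1.trans (by linarith)
  · exact (hr1 q hq).1.trans (by linarith)
  · exact (hr1 p hp).1.trans (by linarith)
  · have := (h4 _ (ball_subset_ball (min_le_right _ _) (h5 y hy).1)).1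
    simp only at this
    rwa [(key y hy).1] at this
  · have := (h4 _ (ball_subset_ball (min_le_right _ _) (h5 y hy).1)).2.1
    simp only at this
    rwa [(key y hy).2] at this
  · intro Hh hHh hHhm hHhd
    have hsm : ∀ p ∈ ball (0 : ℂ × ℂ) r, ‖Hh p‖ < ρq := by
      intro p hp
      have h1 := hHhd p hp
      have h2 := (hr1 p hp).1
      calc ‖Hh p‖ = ‖(Hh p - H p) + H p‖ := by simp
        _ ≤ _ := norm_add_le _ _
        _ < ρq := by linarith
    have main : ∀ y ∈ ball (0 : ℂ × ℂ × ℂ) ρ0,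
        R (Hh (y.1, y.2.2 + I * P y), star (Hh (star (y.2.1, y.2.2 - I * P y)))) = 0 := by
      refine ident_tr (F := fun y => R (Hh (y.1, y.2.2 + I * P y),
        star (Hh (star (y.2.1, y.2.2 - I * P y))))) ?_ ?_
      · intro y hy
        obtain ⟨a1, a2, a3⟩ := h4 y (ball_subset_ball (min_le_right _ _) hy)
        have a2' := star_mem_ball.2 a2
        have b1 : AnalyticAt ℂ (fun y : ℂ × ℂ × ℂ => Hh (y.1, y.2.2 + I * P y)) y :=
          (hHh _ a1).comp_of_eq (f := fun y : ℂ × ℂ × ℂ => (y.1, y.2.2 + I * P y))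
            (analyticAt_fst.prod
            ((analyticAt_snd.comp analyticAt_snd).add (analyticAt_const.mul a3))) rfl
        have b2 : AnalyticAt ℂ (fun y : ℂ × ℂ × ℂ =>
            star (Hh (star (y.2.1, y.2.2 - I * P y)))) y :=
          (analyticAt_star_star (hHh _ a2')).comp_of_eq
            (f := fun y : ℂ × ℂ × ℂ => (y.2.1, y.2.2 - I * P y))
            ((analyticAt_fst.comp analyticAt_snd).prod
            ((analyticAt_snd.comp analyticAt_snd).sub (analyticAt_const.mul a3))) rfl
        exact ((hRan _ _ (hsm _ a1) (hsm _ a2')).comp_of_eq (b1.prod b2) rfl).differentiableAt.differentiableWithinAt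
      · intro z s hy
        obtain ⟨a1, a2, a3⟩ := h4 _ (ball_subset_ball (min_le_right _ _) hy)
        have b1 : P (z, star z, (s : ℂ)) = (φ (z, s) : ℂ) := by
          refine h3 (z, s) ?_
          have := ball_subset_ball (min_le_left _ _) hy
          simp only [mem_ball_zero_iff, Prod.norm_def] at this ⊢
          simp at this ⊢
          exact ⟨this.1, this.2⟩
        simp only at a1 a2 ⊢
        rw [b1] at a1 a2 ⊢
        have e : star (star z, (s : ℂ) - I * (φ (z, s) : ℂ)) = (z, (s : ℂ) + I * (φ (z, s) : ℂ)) := by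
          ext1
          · simp
          · simp
        rw [e]
        rw [(hReq _ (hsm _ a1)).self_of_nhds, hHhm _ ⟨?_, a1⟩]
        · simp
        · simp [Mset]
    intro y hy
    have := main _ (h5 y hy).1
    simp only at this
    rwa [(key y hy).1, (key y hy).2] at this

section nondeg
variable {F : Type*} [NormedAddCommGroup F] [NormedSpace ℂ F]

/-- The complexified CR operator. -/
noncomputable def Lt (rt : (ℂ × ℂ) × (ℂ × ℂ) → ℂ) (g : (ℂ × ℂ) × (ℂ × ℂ) → F)
    (x : (ℂ × ℂ) × (ℂ × ℂ)) : F :=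
  (fderiv ℂ rt x (0, ((0 : ℂ), (1 : ℂ)))) • fderiv ℂ g x (0, ((1 : ℂ), (0 : ℂ)))
    - (fderiv ℂ rt x (0, ((1 : ℂ), (0 : ℂ)))) • fderiv ℂ g x (0, ((0 : ℂ), (1 : ℂ)))

theorem Lt_analytic [CompleteSpace F] {rt : (ℂ × ℂ) × (ℂ × ℂ) → ℂ}
    {g : (ℂ × ℂ) × (ℂ × ℂ) → F} {x : (ℂ × ℂ) × (ℂ × ℂ)}
    (hrt : AnalyticAt ℂ rt x) (hg : AnalyticAt ℂ g x) : AnalyticAt ℂ (Lt rt g) x :=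
  ((an_clm_apply hrt.fderiv _).smul (an_clm_apply hg.fderiv _)).sub
    ((an_clm_apply hrt.fderiv _).smul (an_clm_apply hg.fderiv _))

theorem Lop_eq {φ : ℂ × ℝ → ℝ} {rt : (ℂ × ℂ) × (ℂ × ℂ) → ℂ} (hrt : AnalyticAt ℂ rt 0)
    (hφ : ∀ᶠ p in 𝓝 (0 : ℂ × ℂ), rhoC φ p = rt (p, star p))
    {G : ℂ × ℂ → ℂ × ℂ × ℂ} {g : (ℂ × ℂ) × (ℂ × ℂ) → ℂ × ℂ × ℂ} (hg : AnalyticAt ℂ g 0)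
    (hG : ∀ᶠ p in 𝓝 (0 : ℂ × ℂ), G p = g (p, star p)) :
    ∀ᶠ p in 𝓝 (0 : ℂ × ℂ), Lop φ G p = Lt rt g (p, star p) := by
  have ht : Tendsto (fun p : ℂ × ℂ => (p, star p)) (𝓝 0) (𝓝 0) := by
    have : Continuous (fun p : ℂ × ℂ => (p, star p)) := by fun_prop
    have := this.tendsto 0
    rwa [star_zero] at this
  filter_upwards [hφ.eventually_nhds, hG.eventually_nhds, ht.eventually hrt.eventually_analyticAt,
    ht.eventually hg.eventually_analyticAt] with p h1 h2 h3 h4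
  rw [Lop, Lt, wir_wDerBar h3.differentiableAt h1, wir_wDerBar h3.differentiableAt h1,
    wir_wDerBar h4.differentiableAt h2, wir_wDerBar h4.differentiableAt h2]
  simp [Prod.star_def]

theorem Lt_curve {rt : (ℂ × ℂ) × (ℂ × ℂ) → ℂ} {g : (ℂ × ℂ) × (ℂ × ℂ) → F} {T : ℂ → ℂ} {χ : ℂ}
    (hT : DifferentiableAt ℂ T χ) (hrt : DifferentiableAt ℂ rt (0, (χ, T χ)))
    (hg : DifferentiableAt ℂ g (0, (χ, T χ)))
    (h0 : ∀ᶠ χ in 𝓝 χ, rt (0, (χ, T χ)) = 0) :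
    Lt rt g (0, (χ, T χ)) = (fderiv ℂ rt (0, (χ, T χ)) (0, ((0 : ℂ), (1 : ℂ)))) •
      deriv (fun χ => g (0, (χ, T χ))) χ := by
  have hγ : HasDerivAt (fun χ => (((0 : ℂ × ℂ), (χ, T χ)) : (ℂ × ℂ) × (ℂ × ℂ)))
      (0, (1, deriv T χ)) χ :=
    (hasDerivAt_const χ (0 : ℂ × ℂ)).prodMk ((hasDerivAt_id χ).prodMk hT.hasDerivAt)
  have e : (((0 : ℂ × ℂ), ((1 : ℂ), deriv T χ)) : (ℂ × ℂ) × (ℂ × ℂ)) =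
      (0, ((1 : ℂ), (0 : ℂ))) + deriv T χ • (0, ((0 : ℂ), (1 : ℂ))) := by simp
  have h1 := hrt.hasFDerivAt.comp_hasDerivAt χ hγ
  have h2 := hg.hasFDerivAt.comp_hasDerivAt χ hγ
  have h3 : HasDerivAt (rt ∘ fun χ => (((0 : ℂ × ℂ), (χ, T χ)) : (ℂ × ℂ) × (ℂ × ℂ))) 0 χ :=
    (hasDerivAt_const χ (0 : ℂ)).congr_of_eventuallyEq h0
  have h4 := h1.unique h3
  have h5 : deriv (fun χ => g (0, (χ, T χ))) χ = _ := h2.deriv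
  rw [h5, Lt]
  rw [e, map_add, map_smul] at h4 ⊢
  rw [smul_add, smul_smul, sub_eq_add_neg, ← neg_smul]
  congr 2
  rw [smul_eq_mul] at h4
  linear_combination -h4

end nondeg

theorem line_deriv {F : Type*} [NormedAddCommGroup F] [NormedSpace ℂ F]
    {f : ℂ × ℂ × ℂ → F} {y : ℂ × ℂ × ℂ} (hf : DifferentiableAt ℂ f y) :
    HasDerivAt (fun χ => f (y.1, χ, y.2.2)) (fderiv ℂ f y (0, 1, 0)) y.2.1 := by
  have hγ : HasDerivAt (fun χ : ℂ => ((y.1, χ, y.2.2) : ℂ × ℂ × ℂ)) (0, 1, 0) y.2.1 :=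
    (hasDerivAt_const _ _).prodMk ((hasDerivAt_id _).prodMk (hasDerivAt_const _ _))
  exact hf.hasFDerivAt.comp_hasDerivAt y.2.1 hγ

theorem line_cont (y : ℂ × ℂ × ℂ) :
    Tendsto (fun χ : ℂ => ((y.1, χ, y.2.2) : ℂ × ℂ × ℂ)) (𝓝 y.2.1) (𝓝 y) := by
  have : Continuous (fun χ : ℂ => ((y.1, χ, y.2.2) : ℂ × ℂ × ℂ)) := by fun_prop
  exact this.tendsto y.2.1

theorem clm_apply_fderiv {E F : Type*} [NormedAddCommGroup E] [NormedSpace ℂ E]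
    [NormedAddCommGroup F] [NormedSpace ℂ F] {f : E → F →L[ℂ] ℂ} {y : E}
    (hf : DifferentiableAt ℂ f y) (u : E) (v : F) :
    fderiv ℂ (fun y => f y v) y u = fderiv ℂ f y u v := by
  have := (ContinuousLinearMap.apply ℂ ℂ v).hasFDerivAt.comp y hf.hasFDerivAt
  have h2 : fderiv ℂ (fun y => f y v) y = _ := this.fderiv
  rw [h2]; rfl

theorem line_zero {ℓ : ℂ × ℂ × ℂ → (ℂ × ℂ × ℂ) →L[ℂ] ℂ} {y : ℂ × ℂ × ℂ} (hl : AnalyticAt ℂ ℓ y)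
    {v : ℂ × ℂ × ℂ} (h : ∀ᶠ χ in 𝓝 y.2.1, ℓ (y.1, χ, y.2.2) v = 0) :
    ∀ᶠ χ in 𝓝 y.2.1, fderiv ℂ ℓ (y.1, χ, y.2.2) (0, 1, 0) v = 0 := by
  filter_upwards [h.eventually_nhds, (line_cont y).eventually hl.eventually_analyticAt] with χ h1 h2
  have h3 := line_deriv (an_clm_apply h2 v).differentiableAt
  rw [clm_apply_fderiv h2.differentiableAt] at h3
  exact h3.unique ((hasDerivAt_const χ (0 : ℂ)).congr_of_eventuallyEq h1)

theorem nondeg {φ : ℂ × ℝ → ℝ} {P : ℂ × ℂ × ℂ → ℂ} (hP : AnalyticAt ℂ P 0)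
    (hP2 : ∀ᶠ x in 𝓝 (0 : ℂ × ℝ), P (x.1, star x.1, (x.2 : ℂ)) = (φ x : ℂ))
    {σ : ℂ × ℂ × ℂ → ℂ} (hσ : AnalyticAt ℂ σ 0) (hσ0 : σ 0 = 0)
    (hσe : ∀ᶠ y in 𝓝 (0 : ℂ × ℂ × ℂ), y.2.2 = σ y + I * P (y.1, y.2.1, σ y))
    {ψ : ℂ × ℂ × ℝ → ℝ} {R : (ℂ × ℂ × ℂ) × (ℂ × ℂ × ℂ) → ℂ} (hR : AnalyticAt ℂ R 0)
    (hR2 : ∀ᶠ q in 𝓝 (0 : ℂ × ℂ × ℂ), rhoC' ψ q = R (q, star q))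
    {H : ℂ × ℂ → ℂ × ℂ × ℂ} (hHa : AnalyticAt ℂ H 0) (hH0 : H 0 = 0)
    (hHnd : TwoNondegAt φ ψ H) :
    ∃ ρ2 > (0 : ℝ), ∀ y ∈ ball (0 : ℂ × ℂ × ℂ) ρ2, ∀ v : ℂ × ℂ × ℂ,
      (∀ᶠ χ in 𝓝 y.2.1, fderiv ℂ R (H (y.1, y.2.2),
        star (H (star (χ, 2 * σ (y.1, χ, y.2.2) - y.2.2)))) (v, 0) = 0) → v = 0 := by
  have hHs : AnalyticAt ℂ (fun ζ => star (H (star ζ))) 0 :=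
    analyticAt_star_star (by simpa using hHa)
  -- complexified objects
  let g : (ℂ × ℂ) × (ℂ × ℂ) → (ℂ × ℂ × ℂ) × (ℂ × ℂ × ℂ) →L[ℂ] ℂ :=
    fun x => fderiv ℂ R (H x.1, star (H (star x.2)))
  have hg : AnalyticAt ℂ g 0 := by
    refine hR.fderiv.comp_of_eq (f := fun x : (ℂ × ℂ) × (ℂ × ℂ) => (H x.1, star (H (star x.2))))
      ((hHa.comp_of_eq analyticAt_fst rfl).prod (hHs.comp_of_eq analyticAt_snd rfl)) ?_
    simp [hH0]
  let Gt : (ℂ × ℂ) × (ℂ × ℂ) → ℂ × ℂ × ℂ := fun x =>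
    (g x (((1 : ℂ), (0 : ℂ), (0 : ℂ)), 0), g x (((0 : ℂ), (1 : ℂ), (0 : ℂ)), 0),
      g x (((0 : ℂ), (0 : ℂ), (1 : ℂ)), 0))
  have hGt : AnalyticAt ℂ Gt 0 :=
    (an_clm_apply hg _).prod ((an_clm_apply hg _).prod (an_clm_apply hg _))
  let rt : (ℂ × ℂ) × (ℂ × ℂ) → ℂ := fun x =>
    (2 * I)⁻¹ * (x.1.2 - x.2.2) - P (x.1.1, x.2.1, 2⁻¹ * (x.1.2 + x.2.2))
  have hrt : AnalyticAt ℂ rt 0 := by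
    have a1 : AnalyticAt ℂ (fun x : (ℂ × ℂ) × (ℂ × ℂ) => x.1.2) 0 :=
      analyticAt_snd.comp analyticAt_fst
    have a2 : AnalyticAt ℂ (fun x : (ℂ × ℂ) × (ℂ × ℂ) => x.2.2) 0 :=
      analyticAt_snd.comp analyticAt_snd
    have a3 : AnalyticAt ℂ (fun x : (ℂ × ℂ) × (ℂ × ℂ) => x.1.1) 0 :=
      analyticAt_fst.comp analyticAt_fst
    have a4 : AnalyticAt ℂ (fun x : (ℂ × ℂ) × (ℂ × ℂ) => x.2.1) 0 :=
      analyticAt_fst.comp analyticAt_snd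
    refine (analyticAt_const.mul (a1.sub a2)).sub (hP.comp_of_eq (a3.prod (a4.prod
      (analyticAt_const.mul (a1.add a2)))) ?_)
    simp
  have hrφ : ∀ᶠ p in 𝓝 (0 : ℂ × ℂ), rhoC φ p = rt (p, star p) := by
    have ht : Tendsto (fun p : ℂ × ℂ => ((p.1, p.2.re) : ℂ × ℝ)) (𝓝 0) (𝓝 0) := by
      have : Continuous (fun p : ℂ × ℂ => ((p.1, p.2.re) : ℂ × ℝ)) := by fun_prop
      exact this.tendsto 0
    filter_upwards [ht.eventually hP2] with p hp
    have e1 : (2 * I)⁻¹ * (p.2 - star p.2) = ((p.2.im : ℝ) : ℂ) := by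
      rw [Complex.star_def, Complex.sub_conj]; field_simp; push_cast; ring
    have e2 : 2⁻¹ * (p.2 + star p.2) = ((p.2.re : ℝ) : ℂ) := by
      rw [mul_add]; exact half_add_conj _
    simp only [rt, rhoC, Prod.fst_star, Prod.snd_star]
    rw [e1, e2, hp]; push_cast; rfl
  have hGm : ∀ᶠ p in 𝓝 (0 : ℂ × ℂ), Gmap ψ H p = Gt (p, star p) := by
    have hHt : Tendsto H (𝓝 0) (𝓝 0) := by
      have := hHa.continuousAt.tendsto
      rwa [hH0] at this
    have ht : Tendsto (fun p : ℂ × ℂ => (H p, star (H p))) (𝓝 0) (𝓝 0) := by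
      have := hHt.prodMk_nhds ((continuous_star.tendsto _).comp hHt)
      rwa [star_zero] at this
    filter_upwards [hHt.eventually hR2.eventually_nhds,
      ht.eventually hR.eventually_analyticAt] with p h1 h2
    simp only [Gmap, Gt, g, star_star]
    rw [wir_wDer h2.differentiableAt h1, wir_wDer h2.differentiableAt h1,
      wir_wDer h2.differentiableAt h1]
  have hL1 := Lop_eq hrt hrφ hGt hGm
  have hL2 := Lop_eq hrt hrφ (Lt_analytic hrt hGt) hL1
  have hspan := hHnd.1
  rw [hGm.self_of_nhds, hL1.self_of_nhds, hL2.self_of_nhds, star_zero] at hspan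
  -- the reflected functional
  let K : ℂ × ℂ × ℂ → (ℂ × ℂ) × (ℂ × ℂ) := fun y => ((y.1, y.2.2), (y.2.1, 2 * σ y - y.2.2))
  have hK0 : K 0 = 0 := by simp [K, hσ0]
  have hK : AnalyticAt ℂ K 0 :=
    (analyticAt_fst.prod (analyticAt_snd.comp analyticAt_snd)).prod
      ((analyticAt_fst.comp analyticAt_snd).prod
        ((analyticAt_const.mul hσ).sub (analyticAt_snd.comp analyticAt_snd)))
  let ℓ : ℂ × ℂ × ℂ → (ℂ × ℂ × ℂ) →L[ℂ] ℂ := fun y =>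
    (g (K y)).comp (ContinuousLinearMap.inl ℂ (ℂ × ℂ × ℂ) (ℂ × ℂ × ℂ))
  have hl : AnalyticAt ℂ ℓ 0 :=
    (((ContinuousLinearMap.compL ℂ (ℂ × ℂ × ℂ) ((ℂ × ℂ × ℂ) × (ℂ × ℂ × ℂ)) ℂ).flip
      (ContinuousLinearMap.inl ℂ (ℂ × ℂ × ℂ) (ℂ × ℂ × ℂ))).analyticAt _).comp
        (hg.comp_of_eq hK hK0)
  let D1 : ℂ × ℂ × ℂ → (ℂ × ℂ × ℂ) →L[ℂ] ℂ := fun y => fderiv ℂ ℓ y (0, 1, 0)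
  have hD1 : AnalyticAt ℂ D1 0 := an_clm_apply hl.fderiv _
  let D2 : ℂ × ℂ × ℂ → (ℂ × ℂ × ℂ) →L[ℂ] ℂ := fun y => fderiv ℂ D1 y (0, 1, 0)
  have hD2 : AnalyticAt ℂ D2 0 := an_clm_apply hD1.fderiv _
  let N : ℂ × ℂ × ℂ → (ℂ × ℂ × ℂ) →L[ℂ] (ℂ × ℂ × ℂ) := fun y => (ℓ y).prod ((D1 y).prod (D2 y))
  have hN : ContinuousAt N 0 := by
    have c1 := hl.continuousAt
    have c2 := hD1.continuousAt
    have c3 := hD2.continuousAt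
    have e : N = fun y => (ContinuousLinearMap.inl ℂ ℂ (ℂ × ℂ)).comp (ℓ y) +
        (ContinuousLinearMap.inr ℂ ℂ (ℂ × ℂ)).comp
          ((ContinuousLinearMap.inl ℂ ℂ ℂ).comp (D1 y) +
            (ContinuousLinearMap.inr ℂ ℂ ℂ).comp (D2 y)) := by
      ext y <;> simp [N]
    rw [e]
    exact (continuousAt_const.clm_comp c1).add (continuousAt_const.clm_comp
      ((continuousAt_const.clm_comp c2).add (continuousAt_const.clm_comp c3)))
  have hinj : Function.Injective (N 0) := by
    rw [injective_iff_map_eq_zero]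
    intro v hv
    have v0 : ℓ 0 v = 0 := congrArg Prod.fst hv
    have v1 : D1 0 v = 0 := congrArg (fun q : ℂ × ℂ × ℂ => q.2.1) hv
    have v2 : D2 0 v = 0 := congrArg (fun q : ℂ × ℂ × ℂ => q.2.2) hv
    let Λ : (ℂ × ℂ × ℂ) →L[ℂ] ℂ :=
      v.1 • ContinuousLinearMap.fst ℂ ℂ (ℂ × ℂ) +
      v.2.1 • (ContinuousLinearMap.fst ℂ ℂ ℂ).comp (ContinuousLinearMap.snd ℂ ℂ (ℂ × ℂ)) +
      v.2.2 • (ContinuousLinearMap.snd ℂ ℂ ℂ).comp (ContinuousLinearMap.snd ℂ ℂ (ℂ × ℂ))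
    have hΛ : ∀ q : ℂ × ℂ × ℂ, Λ q = v.1 * q.1 + v.2.1 * q.2.1 + v.2.2 * q.2.2 := by
      intro q; simp [Λ]
    have hΛG : ∀ x, Λ (Gt x) = g x (v, 0) := by
      intro x
      rw [hΛ]
      simp only [Gt]
      rw [← smul_eq_mul, ← smul_eq_mul, ← smul_eq_mul, ← map_smul, ← map_smul, ← map_smul,
        ← map_add, ← map_add]
      congr 1
      simp
    let T : ℂ → ℂ := fun χ => 2 * σ (0, χ, 0)
    have hline : ∀ᶠ χ in 𝓝 (0 : ℂ), AnalyticAt ℂ T χ := by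
      have := (line_cont 0).eventually hσ.eventually_analyticAt
      filter_upwards [this] with χ hχ
      exact analyticAt_const.mul (hχ.comp_of_eq (analyticAt_const.prod
        (analyticAt_id.prod analyticAt_const)) rfl)
    have hT0 : T 0 = 0 := by
      have : σ (0, 0, 0) = 0 := hσ0
      simp [T, this]
    have hγ : AnalyticAt ℂ (fun χ => (((0 : ℂ × ℂ), (χ, T χ)) : (ℂ × ℂ) × (ℂ × ℂ))) 0 :=
      analyticAt_const.prod (analyticAt_id.prod hline.self_of_nhds)
    have hγ0 : (((0 : ℂ × ℂ), ((0 : ℂ), T 0)) : (ℂ × ℂ) × (ℂ × ℂ)) = 0 := by rw [hT0]; rfl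
    have hγt : Tendsto (fun χ => (((0 : ℂ × ℂ), (χ, T χ)) : (ℂ × ℂ) × (ℂ × ℂ))) (𝓝 0) (𝓝 0) := by
      have := hγ.continuousAt.tendsto
      rwa [hγ0] at this
    have hrt0 : ∀ᶠ χ in 𝓝 (0 : ℂ), rt (0, (χ, T χ)) = 0 := by
      filter_upwards [(line_cont 0).eventually hσe] with χ hχ
      simp only [Prod.fst_zero, Prod.snd_zero] at hχ
      simp only [rt, T, Prod.fst_zero, Prod.snd_zero]
      have e : 2⁻¹ * (0 + 2 * σ (0, χ, 0)) = σ (0, χ, 0) := by ring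
      rw [e]
      have e2 : P (0, χ, σ (0, χ, 0)) = I * σ (0, χ, 0) := by
        linear_combination I * hχ + P (0, χ, σ (0, χ, 0)) * I_mul_I
      rw [e2, mul_inv, Complex.inv_I]; ring
    have hcurve : ∀ {g' : (ℂ × ℂ) × (ℂ × ℂ) → ℂ × ℂ × ℂ}, AnalyticAt ℂ g' 0 →
        ∀ᶠ χ in 𝓝 (0 : ℂ), Lt rt g' (0, (χ, T χ)) =
          (fderiv ℂ rt (0, (χ, T χ)) (0, ((0 : ℂ), (1 : ℂ)))) •
            deriv (fun χ => g' (0, (χ, T χ))) χ := by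
      intro g' hg'
      filter_upwards [hline, hrt0.eventually_nhds, hγt.eventually hg'.eventually_analyticAt,
        hγt.eventually hrt.eventually_analyticAt] with χ h1 h2 h3 h4
      exact Lt_curve h1.differentiableAt h4.differentiableAt h3.differentiableAt h2
    set E : ℂ → ℂ × ℂ × ℂ := fun χ => Gt (0, (χ, T χ)) with hE
    have hEa : AnalyticAt ℂ E 0 := hGt.comp_of_eq hγ hγ0
    have hEe : ∀ χ, Λ (E χ) = ℓ (0, χ, 0) v := by
      intro χ
      rw [hE, hΛG]
      simp [ℓ, K, T]
      rfl
    have hEd : ∀ᶠ χ in 𝓝 (0 : ℂ), Λ (deriv E χ) = D1 (0, χ, 0) v := by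
      filter_upwards [hEa.eventually_analyticAt,
        (line_cont 0).eventually hl.eventually_analyticAt] with χ h1 h2
      have h3 := Λ.hasFDerivAt.comp_hasDerivAt χ h1.differentiableAt.hasDerivAt
      have h4 := line_deriv (an_clm_apply h2 v).differentiableAt
      rw [clm_apply_fderiv h2.differentiableAt] at h4
      refine h3.unique (h4.congr_of_eventuallyEq (Eventually.of_forall fun x => hEe x))
    have hEdd : Λ (deriv (deriv E) 0) = D2 0 v := by
      have h3 := Λ.hasFDerivAt.comp_hasDerivAt 0 hEa.deriv.differentiableAt.hasDerivAt
      have h4 := line_deriv (an_clm_apply hD1 v).differentiableAt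
      rw [clm_apply_fderiv hD1.differentiableAt] at h4
      exact h3.unique (h4.congr_of_eventuallyEq hEd)
    have k0 : Λ (Gt 0) = 0 := by
      rw [← hγ0]
      exact (hEe 0).trans v0
    have k1' := (hcurve hGt).self_of_nhds
    have k1 : Λ (Lt rt Gt 0) = 0 := by
      rw [hγ0] at k1'
      rw [k1', map_smul]
      have := hEd.self_of_nhds
      rw [show Λ (deriv E 0) = 0 from this.trans v1, smul_zero]
    have k2 : Λ (Lt rt (Lt rt Gt) 0) = 0 := by
      have h1 := (hcurve (Lt_analytic hrt hGt)).self_of_nhds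
      rw [hγ0] at h1
      have h2 : deriv (fun χ => Lt rt Gt (0, (χ, T χ))) 0 =
          deriv (fun χ => (fderiv ℂ rt (0, (χ, T χ)) (0, ((0 : ℂ), (1 : ℂ)))) • deriv E χ) 0 :=
        Filter.EventuallyEq.deriv_eq (hcurve hGt)
      have hc : AnalyticAt ℂ (fun χ : ℂ => fderiv ℂ rt (0, (χ, T χ)) (0, ((0 : ℂ), (1 : ℂ)))) 0 :=
        (an_clm_apply hrt.fderiv (0, ((0 : ℂ), (1 : ℂ)))).comp_of_eq hγ hγ0
      have h3 := (hc.differentiableAt.hasDerivAt.fun_smul hEa.deriv.differentiableAt.hasDerivAt).deriv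
      rw [h1, h2, h3, map_smul, map_add, map_smul, map_smul, hEdd, v2,
        show Λ (deriv E 0) = 0 from hEd.self_of_nhds.trans v1]
      simp
    have hall : ∀ q : ℂ × ℂ × ℂ, Λ q = 0 := by
      intro q
      have hq : q ∈ Submodule.span ℂ {Gt (0, 0), Lt rt Gt (0, 0), Lt rt (Lt rt Gt) (0, 0)} := by
        rw [hspan]; trivial
      have hle : Submodule.span ℂ {Gt (0, 0), Lt rt Gt (0, 0), Lt rt (Lt rt Gt) (0, 0)} ≤
          LinearMap.ker (Λ : (ℂ × ℂ × ℂ) →ₗ[ℂ] ℂ) := by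
        rw [Submodule.span_le]
        rintro x (rfl | rfl | rfl)
        · exact k0
        · exact k1
        · exact k2
      exact hle hq
    have w1 := hall (1, 0, 0)
    have w2 := hall (0, 1, 0)
    have w3 := hall (0, 0, 1)
    rw [hΛ] at w1 w2 w3
    simp at w1 w2 w3
    ext1
    · exact w1
    ext1
    · exact w2
    · exact w3
  have hev : ∀ᶠ y in 𝓝 (0 : ℂ × ℂ × ℂ), Function.Injective (N y) :=
    hN.tendsto.eventually (ContinuousLinearMap.isOpen_injective.mem_nhds hinj)
  obtain ⟨ρ2, hρ2, h2⟩ := Metric.eventually_nhds_iff_ball.1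
    (hev.and (hl.eventually_analyticAt.and hD1.eventually_analyticAt))
  refine ⟨ρ2, hρ2, fun y hy v hv => ?_⟩
  obtain ⟨b1, b2, b3⟩ := h2 y hy
  have c0 : ∀ᶠ χ in 𝓝 y.2.1, ℓ (y.1, χ, y.2.2) v = 0 := hv
  have c1 : ∀ᶠ χ in 𝓝 y.2.1, D1 (y.1, χ, y.2.2) v = 0 := line_zero b2 c0
  have c2 : ∀ᶠ χ in 𝓝 y.2.1, D2 (y.1, χ, y.2.2) v = 0 := line_zero b3 c1
  apply b1
  rw [map_zero]
  ext1
  · exact c0.self_of_nhds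
  ext1
  · exact c1.self_of_nhds
  · exact c2.self_of_nhds

/-- Scaled coordinates adapted to the quadratic model of `M`. -/
noncomputable def Sh (a : ℂ) (A B : ℝ) (p : ℂ × ℂ) : ℂ × ℂ :=
  ((A : ℂ) * p.1, (B : ℂ) * p.2 + 2 * I * a * ((A : ℂ) * p.1) ^ 2)

/-- Inverse of `Sh`. -/
noncomputable def Shi (a : ℂ) (A B : ℝ) (q : ℂ × ℂ) : ℂ × ℂ :=
  ((A : ℂ)⁻¹ * q.1, (B : ℂ)⁻¹ * (q.2 - 2 * I * a * q.1 ^ 2))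

theorem Sh_Shi (a : ℂ) {A B : ℝ} (hA : 0 < A) (hB : 0 < B) (q : ℂ × ℂ) :
    Sh a A B (Shi a A B q) = q := by
  have hA' : (A : ℂ) ≠ 0 := by exact_mod_cast hA.ne'
  have hB' : (B : ℂ) ≠ 0 := by exact_mod_cast hB.ne'
  ext1
  · simp [Sh, Shi, hA']
  · simp [Sh, Shi, hA', hB']

theorem Shi_Sh (a : ℂ) {A B : ℝ} (hA : 0 < A) (hB : 0 < B) (q : ℂ × ℂ) :
    Shi a A B (Sh a A B q) = q := by
  have hA' : (A : ℂ) ≠ 0 := by exact_mod_cast hA.ne'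
  have hB' : (B : ℂ) ≠ 0 := by exact_mod_cast hB.ne'
  ext1
  · simp [Sh, Shi, hA']
  · simp [Sh, Shi, hB']

theorem Sh_analytic (a : ℂ) (A B : ℝ) (p : ℂ × ℂ) : AnalyticAt ℂ (Sh a A B) p :=
  (analyticAt_const.mul analyticAt_fst).prod ((analyticAt_const.mul analyticAt_snd).add
    (analyticAt_const.mul ((analyticAt_const.mul analyticAt_fst).pow 2)))

theorem Shi_analytic (a : ℂ) (A B : ℝ) (p : ℂ × ℂ) : AnalyticAt ℂ (Shi a A B) p :=
  (analyticAt_const.mul analyticAt_fst).prod (analyticAt_const.mul (analyticAt_snd.sub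
    (analyticAt_const.mul (analyticAt_fst.pow 2))))

theorem Sh_zero (a : ℂ) (A B : ℝ) : Sh a A B 0 = 0 := by simp [Sh]

theorem Shi_zero (a : ℂ) (A B : ℝ) : Shi a A B 0 = 0 := by simp [Shi]

set_option maxHeartbeats 2000000 in
theorem geometry {P : ℂ × ℂ × ℂ → ℂ} (hP : AnalyticAt ℂ P 0)
    (hP1 : fderiv ℂ P 0 = 0) {a b : ℂ} (hb : b ≠ 0)
    (hq : (fun p : ℂ × ℂ => P (p.1, p.2, 0) -
      (a * p.1 ^ 2 + b * p.1 * p.2 + star a * p.2 ^ 2)) =O[𝓝 0] (fun p => ‖p‖ ^ 3))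
    {σ : ℂ × ℂ × ℂ → ℂ} (hσ : AnalyticAt ℂ σ 0) (hσ0 : σ 0 = 0)
    (hσe : ∀ᶠ y in 𝓝 (0 : ℂ × ℂ × ℂ), y.2.2 = σ y + I * P (y.1, y.2.1, σ y))
    {ρ r : ℝ} (hρ : 0 < ρ) (hr : 0 < r) :
    ∃ A > (0 : ℝ), ∃ B > (0 : ℝ), (∀ p ∈ closedBall (0 : ℂ × ℂ) 1, Sh a A B p ∈ ball (0 : ℂ × ℂ) r) ∧
      ∀ p : ℂ × ℂ, ‖p.1‖ = 1 → ‖p.2‖ ≤ 1 → ∃ χ : ℂ,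
        ((Sh a A B p).1, χ, (Sh a A B p).2) ∈ ball (0 : ℂ × ℂ × ℂ) ρ ∧
        Shi a A B (star (χ, 2 * σ ((Sh a A B p).1, χ, (Sh a A B p).2) - (Sh a A B p).2)) ∈
          ball (0 : ℂ × ℂ) 1 := by
  have hb0 : 0 < ‖b‖ := norm_pos_iff.2 hb
  obtain ⟨C, hC0, hC⟩ := hq.exists_pos
  rw [Asymptotics.isBigOWith_iff] at hC
  obtain ⟨ρb, hρb, hC⟩ := Metric.eventually_nhds_iff_ball.1 hC
  set k := ‖b‖ + 2 * ‖a‖ with hk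
  have hk0 : 0 < k := by positivity
  set ε := min (1 / 2) (‖b‖ / (16 * (2 * k + C))) with hε
  have hε0 : 0 < ε := by positivity
  have hε1 : ε ≤ 1 / 2 := min_le_left _ _
  have hε2 : ε * (2 * k + C) ≤ ‖b‖ / 16 := by
    have : ε ≤ ‖b‖ / (16 * (2 * k + C)) := min_le_right _ _
    rw [le_div_iff₀ (by positivity)] at this
    linarith
  have hP' : HasStrictFDerivAt P (0 : ℂ × ℂ × ℂ →L[ℂ] ℂ) 0 := by
    have := hP.hasStrictFDerivAt
    rwa [hP1] at this
  have hst := (hasStrictFDerivAt_iff_isLittleO.1 hP').def hε0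
  obtain ⟨ρa, hρa, hst⟩ := Metric.eventually_nhds_iff_ball.1 hst
  have hσt : ∀ᶠ y in 𝓝 (0 : ℂ × ℂ × ℂ), ‖σ y‖ < ρa := by
    have h1 := hσ.continuousAt.norm.tendsto
    rw [hσ0, norm_zero] at h1
    exact h1.eventually_lt_const hρa
  obtain ⟨ρc, hρc, hσe⟩ := Metric.eventually_nhds_iff_ball.1 (hσe.and hσt)
  obtain ⟨A, hA0, hA⟩ : ∃ A : ℝ, 0 < A ∧ (A < 1 ∧ A * (1 + k) < r ∧ A * (1 + k) < ρ ∧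
      A * (1 + k) < ρa ∧ A * (1 + k) < ρb ∧ A * (1 + k) < ρc ∧ C * A < ‖b‖ / 8) := by
    have hm : ∀ {M : ℝ}, 0 < M → ∀ᶠ A : ℝ in 𝓝[>] 0, A * (1 + k) < M := by
      intro M hM
      have : Continuous (fun A : ℝ => A * (1 + k)) := by fun_prop
      have h := this.tendsto 0
      rw [zero_mul] at h
      exact (h.mono_left nhdsWithin_le_nhds).eventually_lt_const hM
    have hm2 : ∀ᶠ A : ℝ in 𝓝[>] 0, C * A < ‖b‖ / 8 := by
      have : Continuous (fun A : ℝ => C * A) := by fun_prop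
      have h := this.tendsto 0
      rw [mul_zero] at h
      exact (h.mono_left nhdsWithin_le_nhds).eventually_lt_const (by positivity)
    have hm3 : ∀ᶠ A : ℝ in 𝓝[>] 0, A < 1 :=
      (tendsto_id.mono_left nhdsWithin_le_nhds).eventually_lt_const one_pos
    have hm4 : ∀ᶠ A : ℝ in 𝓝[>] 0, 0 < A := self_mem_nhdsWithin
    exact (hm4.and (hm3.and ((hm hr).and ((hm hρ).and ((hm hρa).and ((hm hρb).and
      ((hm hρc).and hm2))))))).exists
  obtain ⟨hA1, hAr, hAρ, hAa, hAb, hAc, hAC⟩ := hA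
  set B := ‖b‖ * A ^ 2 with hB
  have hB0 : 0 < B := by positivity
  have hAA : A ^ 2 ≤ A := by nlinarith
  have hw : ∀ p : ℂ × ℂ, ‖p.1‖ ≤ 1 → ‖p.2‖ ≤ 1 → ‖(Sh a A B p).2‖ ≤ k * A ^ 2 := by
    intro p h1 h2
    simp only [Sh]
    refine (norm_add_le _ _).trans ?_
    simp only [norm_mul, norm_pow, Complex.norm_real, Real.norm_eq_abs, abs_of_pos hA0,
      abs_of_pos hB0, Complex.norm_I, Complex.norm_ofNat]
    have h3 : ‖p.1‖ ^ 2 ≤ 1 := pow_le_one₀ (norm_nonneg _) h1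
    have e1 : B * ‖p.2‖ ≤ B := mul_le_of_le_one_right hB0.le h2
    have e2 : 2 * 1 * ‖a‖ * (A * ‖p.1‖) ^ 2 ≤ 2 * ‖a‖ * A ^ 2 := by
      have : 2 * 1 * ‖a‖ * (A * ‖p.1‖) ^ 2 = 2 * ‖a‖ * A ^ 2 * ‖p.1‖ ^ 2 := by ring
      rw [this]
      exact mul_le_of_le_one_right (by positivity) h3
    rw [hk]
    linarith
  have hkA : k * A ^ 2 ≤ A * (1 + k) := by nlinarith
  have hAk : A ≤ A * (1 + k) := by nlinarith
  refine ⟨A, hA0, B, hB0, ?_, ?_⟩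
  · intro p hp
    rw [mem_closedBall_zero_iff, Prod.norm_def, max_le_iff] at hp
    rw [mem_ball_zero_iff, Prod.norm_def, max_lt_iff]
    constructor
    · simp only [Sh, norm_mul, Complex.norm_real, Real.norm_eq_abs, abs_of_pos hA0]
      have : A * ‖p.1‖ ≤ A := mul_le_of_le_one_right hA0.le hp.1
      linarith
    · have := hw p hp.1 hp.2
      linarith
  · intro p hp1 hp2
    set z := (Sh a A B p).1 with hz
    set w := (Sh a A B p).2 with hwdef
    have hzn : ‖z‖ = A := by
      simp [hz, Sh, hp1, abs_of_pos hA0]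
    have hz0 : z ≠ 0 := by rw [← norm_pos_iff, hzn]; exact hA0
    set χ := (B : ℂ) * p.2 / (2 * I * b * z) with hχ
    have hχn : ‖χ‖ ≤ A / 2 := by
      simp only [hχ, norm_div, norm_mul, Complex.norm_real, Real.norm_eq_abs, abs_of_pos hB0,
        Complex.norm_I, Complex.norm_ofNat, hzn]
      rw [div_le_iff₀ (by positivity), hB]
      have : ‖b‖ * A ^ 2 * ‖p.2‖ ≤ ‖b‖ * A ^ 2 := mul_le_of_le_one_right (by positivity) hp2
      nlinarith
    have hwe : w = 2 * I * (b * z * χ + a * z ^ 2) := by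
      have : (B : ℂ) * p.2 = 2 * I * b * z * χ := by
        rw [hχ]; field_simp
      have e : w = (B : ℂ) * p.2 + 2 * I * a * z ^ 2 := rfl
      rw [e, this]; ring
    have hwn : ‖w‖ ≤ k * A ^ 2 := hw p hp1.le hp2
    have hyn : ‖((z, χ, w) : ℂ × ℂ × ℂ)‖ ≤ A * (1 + k) := by
      rw [Prod.norm_def, Prod.norm_def]
      refine max_le (by simp only; linarith) (max_le ?_ ?_)
      · simp only; linarith
      · simp only; linarith
    refine ⟨χ, ?_, ?_⟩
    · rw [mem_ball_zero_iff]; linarith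
    obtain ⟨hs1, hs2⟩ := hσe (z, χ, w) (by rw [mem_ball_zero_iff]; linarith)
    simp only at hs1
    set s := σ (z, χ, w) with hs
    have hPs : ‖P (z, χ, s) - P (z, χ, 0)‖ ≤ ε * ‖s‖ := by
      have h1 : (((z, χ, s), (z, χ, 0)) : (ℂ × ℂ × ℂ) × (ℂ × ℂ × ℂ)) ∈ ball (0, 0) ρa := by
        rw [← Prod.mk_zero_zero]
        simp only [mem_ball_zero_iff, Prod.norm_def, max_lt_iff, Prod.mk_zero_zero]
        refine ⟨⟨?_, ?_, ?_⟩, ?_, ?_, ?_⟩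
        · linarith
        · linarith
        · exact hs2
        · linarith
        · linarith
        · simpa using hρa
      have h2 := hst _ h1
      simpa [Prod.norm_def] using h2
    have hn2 : ‖((z, χ) : ℂ × ℂ)‖ = A := by
      rw [Prod.norm_def]
      simp only [hzn]
      exact max_eq_left (by linarith)
    have hE0 : ‖P (z, χ, 0) - (a * z ^ 2 + b * z * χ + star a * χ ^ 2)‖ ≤ C * A ^ 3 := by
      have h1 := hC (z, χ) (by rw [mem_ball_zero_iff, hn2]; linarith)
      simp only [hn2] at h1
      rwa [Real.norm_of_nonneg (by positivity)] at h1
    have hquadn : ‖a * z ^ 2 + b * z * χ + star a * χ ^ 2‖ ≤ k * A ^ 2 := by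
      refine (norm_add₃_le).trans ?_
      simp only [norm_mul, norm_pow, norm_star, hzn]
      have e1 : ‖b‖ * A * ‖χ‖ ≤ ‖b‖ * A * (A / 2) := by gcongr
      have e2 : ‖a‖ * ‖χ‖ ^ 2 ≤ ‖a‖ * (A / 2) ^ 2 := by gcongr
      have e3 : 0 ≤ ‖a‖ * A ^ 2 := by positivity
      have e4 : 0 ≤ ‖b‖ * A ^ 2 := by positivity
      rw [hk]
      nlinarith
    have hA3 : C * A ^ 3 ≤ C * A ^ 2 := by
      have : A ^ 3 ≤ A ^ 2 := by nlinarith [sq_nonneg A]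
      exact mul_le_mul_of_nonneg_left this hC0.le
    have hP0n : ‖P (z, χ, 0)‖ ≤ (k + C) * A ^ 2 := by
      calc ‖P (z, χ, 0)‖ = ‖(P (z, χ, 0) - (a * z ^ 2 + b * z * χ + star a * χ ^ 2)) +
            (a * z ^ 2 + b * z * χ + star a * χ ^ 2)‖ := by congr 1; ring
        _ ≤ _ := norm_add_le _ _
        _ ≤ (k + C) * A ^ 2 := by linarith
    have hsn : ‖s‖ ≤ 2 * (2 * k + C) * A ^ 2 := by
      have e : s = w - I * ((P (z, χ, s) - P (z, χ, 0)) + P (z, χ, 0)) := by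
        linear_combination -hs1
      have h1 : ‖s‖ ≤ ‖w‖ + (ε * ‖s‖ + ‖P (z, χ, 0)‖) := by
        calc ‖s‖ = ‖w - I * ((P (z, χ, s) - P (z, χ, 0)) + P (z, χ, 0))‖ := by rw [← e]
          _ ≤ ‖w‖ + ‖I * ((P (z, χ, s) - P (z, χ, 0)) + P (z, χ, 0))‖ := norm_sub_le _ _
          _ = ‖w‖ + ‖(P (z, χ, s) - P (z, χ, 0)) + P (z, χ, 0)‖ := by simp
          _ ≤ ‖w‖ + (ε * ‖s‖ + ‖P (z, χ, 0)‖) := by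
            gcongr
            exact (norm_add_le _ _).trans (by linarith)
      have h2 : ε * ‖s‖ ≤ 1 / 2 * ‖s‖ := by gcongr
      linarith
    have hT : ‖(2 * s - w) + 2 * I * star a * χ ^ 2‖ < B := by
      have e : (2 * s - w) + 2 * I * star a * χ ^ 2 = (-2 * I) * ((P (z, χ, s) - P (z, χ, 0)) +
          (P (z, χ, 0) - (a * z ^ 2 + b * z * χ + star a * χ ^ 2))) := by
        linear_combination hwe - 2 * hs1
      rw [e, norm_mul]
      have e2 : ‖(-2 * I : ℂ)‖ = 2 := by simp
      rw [e2]
      have h1 : ε * ‖s‖ ≤ ‖b‖ / 8 * A ^ 2 := by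
        calc ε * ‖s‖ ≤ ε * (2 * (2 * k + C) * A ^ 2) := by gcongr
          _ = 2 * (ε * (2 * k + C)) * A ^ 2 := by ring
          _ ≤ 2 * (‖b‖ / 16) * A ^ 2 := by gcongr
          _ = _ := by ring
      have h2 : C * A ^ 3 ≤ ‖b‖ / 8 * A ^ 2 := by
        calc C * A ^ 3 = C * A * A ^ 2 := by ring
          _ ≤ _ := by gcongr
      have h3 := norm_add_le (P (z, χ, s) - P (z, χ, 0))
        (P (z, χ, 0) - (a * z ^ 2 + b * z * χ + star a * χ ^ 2))
      have h4 : 0 < ‖b‖ * A ^ 2 := by positivity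
      rw [hB]
      nlinarith
    rw [mem_ball_zero_iff, Prod.norm_def, max_lt_iff]
    constructor
    · simp only [Shi, Prod.fst_star, norm_mul, norm_inv, Complex.norm_real, Real.norm_eq_abs,
        abs_of_pos hA0, norm_star]
      rw [inv_mul_lt_iff₀ hA0]; linarith
    · have e : (star (2 * s - w) - 2 * I * a * (star χ) ^ 2) =
          star ((2 * s - w) + 2 * I * star a * χ ^ 2) := by
        simp; ring
      simp only [Shi, Prod.fst_star, Prod.snd_star]
      rw [e, norm_mul, norm_star]
      simp only [norm_inv, Complex.norm_real, Real.norm_eq_abs, abs_of_pos hB0]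
      rw [inv_mul_lt_iff₀ hB0]; linarith


theorem max_boundary {F : Type*} [NormedAddCommGroup F] [NormedSpace ℂ F]
    {d : ℂ × ℂ → F} {U : Set (ℂ × ℂ)} (hd : AnalyticOnNhd ℂ d U) (hU : closedBall 0 1 ⊆ U) :
    ∃ x : ℂ × ℂ, ‖x.1‖ = 1 ∧ ‖x.2‖ ≤ 1 ∧ ∀ p ∈ closedBall (0 : ℂ × ℂ) 1, ‖d p‖ ≤ ‖d x‖ := by
  have hc : ContinuousOn (fun p => ‖d p‖) (closedBall (0 : ℂ × ℂ) 1) :=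
    (hd.continuousOn.mono hU).norm
  obtain ⟨x0, hx0, hmax⟩ := (isCompact_closedBall (0 : ℂ × ℂ) 1).exists_isMaxOn
    ⟨0, by simp⟩ hc
  have hx0' : ‖x0.1‖ ≤ 1 ∧ ‖x0.2‖ ≤ 1 := by
    rwa [mem_closedBall_zero_iff, Prod.norm_def, max_le_iff] at hx0
  have hmem : ∀ z : ℂ, ‖z‖ ≤ 1 → (z, x0.2) ∈ closedBall (0 : ℂ × ℂ) 1 := by
    intro z hz
    rw [mem_closedBall_zero_iff, Prod.norm_def, max_le_iff]
    exact ⟨hz, hx0'.2⟩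
  have hdiff : DifferentiableOn ℂ (fun z => d (z, x0.2)) (closedBall 0 1) := by
    intro z hz
    have h1 := hd _ (hU (hmem z (by simpa using hz)))
    exact (h1.comp_of_eq (f := fun z : ℂ => (z, x0.2)) (analyticAt_id.prod analyticAt_const)
      rfl).differentiableAt.differentiableWithinAt
  have hcl : DiffContOnCl ℂ (fun z => d (z, x0.2)) (ball 0 1) := by
    apply DifferentiableOn.diffContOnCl
    rwa [closure_ball (0 : ℂ) one_ne_zero]
  obtain ⟨z1, hz1, hz1m⟩ := Complex.exists_mem_frontier_isMaxOn_norm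
    (isBounded_ball (x := (0 : ℂ)) (r := 1)) ⟨0, by simp⟩ hcl
  rw [frontier_ball (0 : ℂ) one_ne_zero, mem_sphere_zero_iff_norm] at hz1
  refine ⟨(z1, x0.2), hz1, hx0'.2, fun p hp => (hmax hp).trans ?_⟩
  have : x0.1 ∈ closure (ball (0 : ℂ) 1) := by
    rw [closure_ball (0 : ℂ) one_ne_zero]; simpa using hx0'.1
  exact hz1m this

theorem strict_lim {E : Type*} [NormedAddCommGroup E] [NormedSpace ℂ E] {R : E → ℂ}
    {R' : E →L[ℂ] ℂ} {X : E} (hR : HasStrictFDerivAt R R' X) {x V : ℕ → E} {v : E} {η : ℕ → ℝ}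
    (hx : Tendsto x atTop (𝓝 X)) (hη : Tendsto η atTop (𝓝 0)) (hη0 : ∀ n, 0 < η n)
    (hV : Tendsto V atTop (𝓝 v))
    (h : ∀ᶠ n in atTop, R (x n + (η n : ℂ) • V n) = R (x n)) : R' v = 0 := by
  have hηc : Tendsto (fun n => (η n : ℂ)) atTop (𝓝 0) := by
    have := (Complex.continuous_ofReal.tendsto 0).comp hη
    rw [Complex.ofReal_zero] at this
    exact this
  have h1 : Tendsto (fun n => (x n + (η n : ℂ) • V n, x n)) atTop (𝓝 (X, X)) := by
    have := hx.add (hηc.smul hV)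
    rw [zero_smul, add_zero] at this
    exact this.prodMk_nhds hx
  have h2 : Tendsto (fun n => R' (V n)) atTop (𝓝 0) := by
    rw [Metric.tendsto_nhds]
    intro ε hε
    have hVb : ∀ᶠ n in atTop, ‖V n‖ < ‖v‖ + 1 := hV.norm.eventually_lt_const (by linarith)
    have hc : 0 < ε / (2 * (‖v‖ + 1)) := by positivity
    have h3 := h1.eventually ((hasStrictFDerivAt_iff_isLittleO.1 hR).def hc)
    filter_upwards [h, h3, hVb] with n a1 a2 a3
    simp only [a1, sub_self, add_sub_cancel_left, zero_sub, norm_neg, map_smul, norm_smul,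
      Complex.norm_real, Real.norm_of_nonneg (hη0 n).le] at a2
    have a4 : η n * ‖R' (V n)‖ ≤ η n * (ε / (2 * (‖v‖ + 1)) * ‖V n‖) := a2.trans (le_of_eq (by ring))
    have a5 := le_of_mul_le_mul_left a4 (hη0 n)
    rw [dist_zero_right]
    calc ‖R' (V n)‖ ≤ ε / (2 * (‖v‖ + 1)) * ‖V n‖ := a5
      _ ≤ ε / (2 * (‖v‖ + 1)) * (‖v‖ + 1) := by gcongr
      _ = ε / 2 := by field_simp
      _ < ε := by linarith
  exact tendsto_nhds_unique ((R'.continuous.tendsto v).comp hV) h2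

theorem re_grad {ψ : ℂ × ℂ × ℝ → ℝ} {ρ' : ℂ × ℂ × ℂ → ℝ} (hρ : ∀ q, rhoC' ψ q = (ρ' q : ℂ))
    {H : ℂ × ℂ → ℂ × ℂ × ℂ} {p : ℂ × ℂ} (hd : DifferentiableAt ℝ ρ' (H p)) (v : ℂ × ℂ × ℂ) :
    (v.1 * (Gmap ψ H p).1 + v.2.1 * (Gmap ψ H p).2.1 + v.2.2 * (Gmap ψ H p).2.2).re =
      2⁻¹ * fderiv ℝ ρ' (H p) v := by
  have h1 : ∀ u, fderiv ℝ (rhoC' ψ) (H p) u = ((fderiv ℝ ρ' (H p) u : ℝ) : ℂ) := by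
    intro u
    have e : rhoC' ψ = fun q => (ρ' q : ℂ) := funext hρ
    have h5 : HasFDerivAt (fun q => (ρ' q : ℂ)) (Complex.ofRealCLM.comp (fderiv ℝ ρ' (H p))) (H p) :=
      Complex.ofRealCLM.hasFDerivAt.comp (H p) hd.hasFDerivAt
    rw [e, h5.fderiv]; rfl
  have hv : v = v.1.re • ((1 : ℂ), (0 : ℂ), (0 : ℂ)) + v.1.im • (I • ((1 : ℂ), (0 : ℂ), (0 : ℂ)))
      + v.2.1.re • ((0 : ℂ), (1 : ℂ), (0 : ℂ)) + v.2.1.im • (I • ((0 : ℂ), (1 : ℂ), (0 : ℂ)))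
      + v.2.2.re • ((0 : ℂ), (0 : ℂ), (1 : ℂ)) + v.2.2.im • (I • ((0 : ℂ), (0 : ℂ), (1 : ℂ))) := by
    ext1
    · apply Complex.ext <;> simp
    ext1
    · apply Complex.ext <;> simp
    · apply Complex.ext <;> simp
  conv_rhs => rw [hv]
  simp only [map_add, map_smul]
  simp only [Gmap, wDer, h1]
  simp
  ring

/-- The limit of the normalized differences is an infinitesimal deformation. -/
theorem limit_infdef {φ : ℂ × ℝ → ℝ} {ψ : ℂ × ℂ × ℝ → ℝ} {ρ' : ℂ × ℂ × ℂ → ℝ}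
    (hρ : ∀ q, rhoC' ψ q = (ρ' q : ℂ)) (hρa : AnalyticAt ℝ ρ' 0)
    {H : ℂ × ℂ → ℂ × ℂ × ℂ} (hHa : AnalyticAt ℂ H 0) (hH0 : H 0 = 0)
    {Hn : ℕ → ℂ × ℂ → ℂ × ℂ × ℂ} {r : ℝ} (hr : 0 < r)
    (hHm : ∀ p ∈ Mset φ ∩ ball 0 r, ρ' (H p) = 0)
    (hHnm : ∀ n, ∀ p ∈ Mset φ ∩ ball 0 r, ρ' (Hn n p) = 0)
    (hHn0 : ∀ n, Hn n 0 = 0)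
    {η : ℕ → ℝ} (hη0 : ∀ n, 0 < η n) (hη : Tendsto η atTop (𝓝 0))
    {α : ℂ × ℂ → ℂ × ℂ × ℂ} (hα : AnalyticAt ℂ α 0)
    (hlim : ∀ᶠ p in 𝓝 (0 : ℂ × ℂ),
      Tendsto (fun n => (η n)⁻¹ • (Hn n p - H p)) atTop (𝓝 (α p))) :
    IsInfDef φ ψ H α := by
  refine ⟨hα, ?_, ?_⟩
  · have h1 := hlim.self_of_nhds
    simp only [hHn0, hH0, sub_self, smul_zero] at h1
    exact tendsto_nhds_unique h1 tendsto_const_nhds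
  · have hd : ∀ᶠ p in 𝓝 (0 : ℂ × ℂ), AnalyticAt ℝ ρ' (H p) := by
      have h2 : Tendsto H (𝓝 0) (𝓝 0) := by
        have := hHa.continuousAt.tendsto
        rwa [hH0] at this
      exact h2.eventually hρa.eventually_analyticAt
    filter_upwards [hd, hlim, ball_mem_nhds 0 hr] with p h1 h2 h3 hpM
    have hdp := h1.differentiableAt
    rw [re_grad hρ hdp]
    have hd0 : Tendsto (fun n => Hn n p - H p) atTop (𝓝 0) := by
      have h6 := hη.smul h2
      rw [zero_smul] at h6
      refine h6.congr fun n => ?_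
      rw [smul_inv_smul₀ (hη0 n).ne']
    have h4 := (hdp.hasFDerivAt.hasFDerivWithinAt (s := Set.univ)).lim hd0
      (Eventually.of_forall fun _ => Set.mem_univ _) h2
    have h5 : ∀ n, (η n)⁻¹ • (ρ' (H p + (Hn n p - H p)) - ρ' (H p)) = 0 := by
      intro n
      rw [add_sub_cancel, hHnm n p ⟨hpM, h3⟩, hHm p ⟨hpM, h3⟩]; simp
    simp only [h5] at h4
    rw [tendsto_nhds_unique h4 tendsto_const_nhds, mul_zero]

set_option maxHeartbeats 1000000 in
/-- The final contradiction: the normalized maxima cannot converge to a nonzero vector. -/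
theorem final_step {σ : ℂ × ℂ × ℂ → ℂ} {R : (ℂ × ℂ × ℂ) × (ℂ × ℂ × ℂ) → ℂ}
    {H : ℂ × ℂ → ℂ × ℂ × ℂ} {Hn f : ℕ → ℂ × ℂ → ℂ × ℂ × ℂ} {r ρ : ℝ} {a : ℂ} {A B : ℝ}
    (hA : 0 < A) (hB : 0 < B)
    (hH : AnalyticOnNhd ℂ H (ball 0 r))
    (hRa : ∀ p ∈ ball (0 : ℂ × ℂ) r, ∀ q ∈ ball (0 : ℂ × ℂ) r, AnalyticAt ℂ R (H p, star (H q)))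
    (hσy : ∀ y ∈ ball (0 : ℂ × ℂ × ℂ) ρ, AnalyticAt ℂ σ y ∧ (y.1, y.2.2) ∈ ball (0 : ℂ × ℂ) r ∧
        (y.2.1, 2 * σ y - y.2.2) ∈ ball (0 : ℂ × ℂ) r)
    (hRH : ∀ y ∈ ball (0 : ℂ × ℂ × ℂ) ρ,
      R (H (y.1, y.2.2), star (H (star (y.2.1, 2 * σ y - y.2.2)))) = 0)
    (hRn : ∀ n, ∀ y ∈ ball (0 : ℂ × ℂ × ℂ) ρ,
      R (Hn n (y.1, y.2.2), star (Hn n (star (y.2.1, 2 * σ y - y.2.2)))) = 0)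
    {η : ℕ → ℝ} (hη0 : ∀ n, 0 < η n) (hη : Tendsto η atTop (𝓝 0))
    (hf : ∀ n p, Hn n (Sh a A B p) = H (Sh a A B p) + (η n : ℂ) • f n p)
    (hlim : ∀ (x : ℕ → ℂ × ℂ) (p : ℂ × ℂ), p ∈ ball (0 : ℂ × ℂ) 1 → Tendsto x atTop (𝓝 p) →
        Tendsto (fun n => f n (x n)) atTop (𝓝 0))
    {x : ℕ → ℂ × ℂ} {xs : ℂ × ℂ} {v : ℂ × ℂ × ℂ} (hx : Tendsto x atTop (𝓝 xs))
    (hv : Tendsto (fun n => f n (x n)) atTop (𝓝 v)) {χ₀ : ℂ}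
    (hχ1 : ((Sh a A B xs).1, χ₀, (Sh a A B xs).2) ∈ ball (0 : ℂ × ℂ × ℂ) ρ)
    (hχ2 : Shi a A B (star (χ₀, 2 * σ ((Sh a A B xs).1, χ₀, (Sh a A B xs).2) - (Sh a A B xs).2)) ∈
          ball (0 : ℂ × ℂ) 1) :
    ∀ᶠ χ in 𝓝 χ₀, fderiv ℂ R (H (Sh a A B xs),
        star (H (star (χ, 2 * σ ((Sh a A B xs).1, χ, (Sh a A B xs).2) - (Sh a A B xs).2)))) (v, 0)
          = 0 := by
  set Z := Sh a A B xs with hZ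
  have hShc : Continuous (Sh a A B) :=
    continuous_iff_continuousAt.2 fun p => (Sh_analytic a A B p).continuousAt
  have hShic : Continuous (Shi a A B) :=
    continuous_iff_continuousAt.2 fun p => (Shi_analytic a A B p).continuousAt
  have hyc : Continuous (fun χ : ℂ => (Z.1, χ, Z.2)) := by fun_prop
  have hev1 : ∀ᶠ χ in 𝓝 χ₀, (Z.1, χ, Z.2) ∈ ball (0 : ℂ × ℂ × ℂ) ρ :=
    hyc.continuousAt.eventually (isOpen_ball.mem_nhds hχ1)
  have hev2 : ∀ᶠ χ in 𝓝 χ₀, Shi a A B (star (χ, 2 * σ (Z.1, χ, Z.2) - Z.2)) ∈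
      ball (0 : ℂ × ℂ) 1 := by
    have h1 : ContinuousAt (fun χ : ℂ => σ (Z.1, χ, Z.2)) χ₀ :=
      ContinuousAt.comp (f := fun χ : ℂ => (Z.1, χ, Z.2)) (hσy _ hχ1).1.continuousAt
        hyc.continuousAt
    have h2 : ContinuousAt (fun χ : ℂ => Shi a A B (star (χ, 2 * σ (Z.1, χ, Z.2) - Z.2))) χ₀ :=
      ContinuousAt.comp (g := fun ζ : ℂ × ℂ => Shi a A B (star ζ))
        (hShic.comp continuous_star).continuousAt
        (continuousAt_id.prodMk ((continuousAt_const.mul h1).sub continuousAt_const))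
    exact h2.eventually (isOpen_ball.mem_nhds hχ2)
  filter_upwards [hev1, hev2] with χ h1 h2
  obtain ⟨hσa, hm1, hm2⟩ := hσy _ h1
  simp only at hm1 hm2
  -- the sequences
  have hZn : Tendsto (fun n => Sh a A B (x n)) atTop (𝓝 Z) := (hShc.tendsto xs).comp hx
  have hyn : Tendsto (fun n => ((Sh a A B (x n)).1, χ, (Sh a A B (x n)).2)) atTop
      (𝓝 (Z.1, χ, Z.2)) :=
    (Continuous.tendsto (f := fun z : ℂ × ℂ => (z.1, χ, z.2)) (by fun_prop) Z).comp hZn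
  have hσn : Tendsto (fun n => σ ((Sh a A B (x n)).1, χ, (Sh a A B (x n)).2)) atTop
      (𝓝 (σ (Z.1, χ, Z.2))) := hσa.continuousAt.tendsto.comp hyn
  have hζn : Tendsto (fun n => star (χ, 2 * σ ((Sh a A B (x n)).1, χ, (Sh a A B (x n)).2)
      - (Sh a A B (x n)).2)) atTop (𝓝 (star (χ, 2 * σ (Z.1, χ, Z.2) - Z.2))) := by
    refine (continuous_star.tendsto _).comp ?_
    refine tendsto_const_nhds.prodMk_nhds ((hσn.const_mul 2).sub ?_)
    exact (continuous_snd.tendsto Z).comp hZn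
  have hpn := (hShic.tendsto _).comp hζn
  have hfp := hlim _ _ h2 hpn
  have hHZ : ContinuousAt H Z := (hH Z hm1).continuousAt
  have hHζ : ContinuousAt H (star (χ, 2 * σ (Z.1, χ, Z.2) - Z.2)) :=
    (hH _ (star_mem_ball.2 hm2)).continuousAt
  have hX : Tendsto (fun n => (H (Sh a A B (x n)), star (H (star (χ,
      2 * σ ((Sh a A B (x n)).1, χ, (Sh a A B (x n)).2) - (Sh a A B (x n)).2))))) atTop
      (𝓝 (H Z, star (H (star (χ, 2 * σ (Z.1, χ, Z.2) - Z.2))))) :=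
    (hHZ.tendsto.comp hZn).prodMk_nhds ((continuous_star.tendsto _).comp (hHζ.tendsto.comp hζn))
  have hfs := (continuous_star.tendsto _).comp hfp
  rw [star_zero] at hfs
  have hV := hv.prodMk_nhds hfs
  refine strict_lim (hRa Z hm1 _ (star_mem_ball.2 hm2)).hasStrictFDerivAt hX hη hη0 hV ?_
  filter_upwards [hyn.eventually (isOpen_ball.mem_nhds h1)] with n hn
  have e1 := hRH _ hn
  have e2 := hRn n _ hn
  simp only at e1 e2
  have e3 : ∀ q, Hn n q = H q + (η n : ℂ) • f n (Shi a A B q) := by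
    intro q
    have := hf n (Shi a A B q)
    rwa [Sh_Shi a hA hB] at this
  have e4 : Hn n ((Sh a A B (x n)).1, (Sh a A B (x n)).2) =
    H (Sh a A B (x n)) + (η n : ℂ) • f n (x n) := hf n (x n)
  rw [e4, e3] at e2
  refine Eq.trans ?_ (e2.trans e1.symm)
  congr 1
  ext1
  · rfl
  · simp only [Prod.snd_add, Prod.smul_snd, star_add, star_smul, Function.comp_def]
    simp

/-- if a `2`-nondegenerate transversal embedding `H : M → M'` with `M`
strictly pseudoconvex has no nontrivial infinitesimal deformation, then `H` is isolated
among such embeddings. -/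
theorem stmt_0 (φ : ℂ × ℝ → ℝ) (hφa : AnalyticAt ℝ φ 0) (hφ0 : φ 0 = 0)
    (hφ1 : fderiv ℝ φ 0 = 0)
    (hφspc : ∃ cℓ : ℝ, 0 < cℓ
      ∧ wzPhi (fun p => wzBarPhi (fun q => ((φ q : ℝ) : ℂ)) p) 0 = (cℓ : ℂ))
    (ψ : ℂ × ℂ × ℝ → ℝ) (hψa : AnalyticAt ℝ ψ 0) (hψ0 : ψ 0 = 0)
    (hψ1 : fderiv ℝ ψ 0 = 0)
    (H : ℂ × ℂ → ℂ × ℂ × ℂ) (hHa : AnalyticAt ℂ H 0) (hH0 : H 0 = 0)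
    (hHinj : Function.Injective (fderiv ℂ H 0))
    (hHmap : ∀ᶠ p in 𝓝 (0 : ℂ × ℂ), p ∈ Mset φ → H p ∈ M'set ψ)
    (hHtr : TransversalAt H) (hHnd : TwoNondegAt φ ψ H)
    (hinf : ∀ α : ℂ × ℂ → ℂ × ℂ × ℂ, IsInfDef φ ψ H α →
      ∀ᶠ p in 𝓝 (0 : ℂ × ℂ), α p = 0) :
    ∃ r > (0 : ℝ), ∃ δ > (0 : ℝ), ∀ Hhat : ℂ × ℂ → ℂ × ℂ × ℂ,
      AnalyticOnNhd ℂ Hhat (ball (0 : ℂ × ℂ) r) → Hhat 0 = 0 →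
      (∀ p ∈ Mset φ ∩ ball (0 : ℂ × ℂ) r, Hhat p ∈ M'set ψ) →
      TransversalAt Hhat → TwoNondegAt φ ψ Hhat →
      (∀ p ∈ ball (0 : ℂ × ℂ) r, ‖Hhat p - H p‖ < δ) →
      ∀ p ∈ ball (0 : ℂ × ℂ) r, Hhat p = H p := by
  set ρ' : ℂ × ℂ × ℂ → ℝ := fun q => q.2.2.im - ψ (q.1, q.2.1, q.2.2.re) with hρ'
  have hρ : ∀ q, rhoC' ψ q = (ρ' q : ℂ) := fun q => rfl
  have hM' : ∀ q, q ∈ M'set ψ ↔ ρ' q = 0 := fun q => by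
    rw [hρ', sub_eq_zero]; rfl
  have hρa : AnalyticAt ℝ ρ' 0 := by
    have h22 : AnalyticAt ℝ (fun q : ℂ × ℂ × ℂ => q.2.2) 0 := analyticAt_snd.comp analyticAt_snd
    have him : AnalyticAt ℝ (fun q : ℂ × ℂ × ℂ => q.2.2.im) 0 :=
      (Complex.imCLM.analyticAt _).comp h22
    have hre : AnalyticAt ℝ (fun q : ℂ × ℂ × ℂ => q.2.2.re) 0 :=
      (Complex.reCLM.analyticAt _).comp h22
    have h21 : AnalyticAt ℝ (fun q : ℂ × ℂ × ℂ => q.2.1) 0 := analyticAt_fst.comp analyticAt_snd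
    exact him.sub (hψa.comp_of_eq (f := fun q : ℂ × ℂ × ℂ => (q.1, q.2.1, q.2.2.re))
      (analyticAt_fst.prod (h21.prod hre)) (by simp))
  obtain ⟨P, hP, hP2⟩ := exP φ hφa
  obtain ⟨R, hR, hR2⟩ := exR ρ' hρa
  have hP0 := P_zero hφ0 hP2
  have hP1 := P_fderiv hφa hφ1 hP hP2
  obtain ⟨a, b, hb, hq⟩ := P_quad hφa hφ0 hφ1 hP hP2 hφspc
  obtain ⟨σ, hσ, hσ0, hσe⟩ := exSigma hP hP0 hP1
  obtain ⟨r, hr, δ0, hδ0, ρ1, hρ1, hHr, hHm, hRa, -, hσy, hrefl⟩ :=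
    reflect hP hP0 hP2 hσ hσ0 hσe hR hR2 hHa hH0
      (hHmap.mono fun p hp hpM => (hM' _).1 (hp hpM))
  obtain ⟨ρ2, hρ2, hnd⟩ := nondeg hP hP2 hσ hσ0 hσe (ψ := ψ) hR
    (hR2.mono fun q hq => hq.symm) hHa hH0 hHnd
  obtain ⟨A, hA, B, hB, hShr, hgeo⟩ := geometry hP hP1 hb hq hσ hσ0 hσe (lt_min hρ1 hρ2) hr
  refine ⟨r, hr, ?_⟩
  by_contra hcon
  have hex : ∀ n : ℕ, ∃ Hh : ℂ × ℂ → ℂ × ℂ × ℂ, AnalyticOnNhd ℂ Hh (ball 0 r) ∧ Hh 0 = 0 ∧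
      (∀ p ∈ Mset φ ∩ ball 0 r, ρ' (Hh p) = 0) ∧
      (∀ p ∈ ball (0 : ℂ × ℂ) r, ‖Hh p - H p‖ < min δ0 (1 / ((n : ℝ) + 1))) ∧
      ∃ p ∈ ball (0 : ℂ × ℂ) r, Hh p ≠ H p := by
    intro n
    by_contra hno
    refine hcon ⟨min δ0 (1 / ((n : ℝ) + 1)), lt_min hδ0 (by positivity), ?_⟩
    intro Hh h1 h2 h3 _ _ h4 p hp
    by_contra hne
    exact hno ⟨Hh, h1, h2, fun p hp => (hM' _).1 (h3 p hp), h4, p, hp, hne⟩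
  choose Hn hn1 hn2 hn3 hn4 hn5 using hex
  have hShc : Continuous (Sh a A B) :=
    continuous_iff_continuousAt.2 fun p => (Sh_analytic a A B p).continuousAt
  have hShic : Continuous (Shi a A B) :=
    continuous_iff_continuousAt.2 fun p => (Shi_analytic a A B p).continuousAt
  -- the differences in the rescaled coordinates
  set U : Set (ℂ × ℂ) := Sh a A B ⁻¹' ball 0 r with hU
  have hUo : IsOpen U := isOpen_ball.preimage hShc
  have hUb : closedBall 0 1 ⊆ U := fun p hp => hShr p hp
  set d : ℕ → ℂ × ℂ → ℂ × ℂ × ℂ := fun n p => Hn n (Sh a A B p) - H (Sh a A B p) with hd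
  have hda : ∀ n, AnalyticOnNhd ℂ (d n) U := fun n p hp =>
    ((hn1 n _ hp).comp (Sh_analytic a A B p)).sub ((hHr _ hp).comp (Sh_analytic a A B p))
  choose x hx1 hx2 hx3 using fun n => max_boundary (hda n) hUb
  have hxm : ∀ n, x n ∈ closedBall (0 : ℂ × ℂ) 1 := fun n => by
    rw [mem_closedBall_zero_iff, Prod.norm_def, max_le_iff]; exact ⟨(hx1 n).le, hx2 n⟩
  set η : ℕ → ℝ := fun n => ‖d n (x n)‖ with hηd
  have hη0 : ∀ n, 0 < η n := by
    intro n
    refine norm_pos_iff.2 fun h0 => ?_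
    obtain ⟨p, hp, hne⟩ := hn5 n
    refine hne ?_
    refine (hn1 n).eqOn_of_preconnected_of_eventuallyEq hHr
      (convex_ball (0 : ℂ × ℂ) r).isPreconnected (mem_ball_self hr) ?_ hp
    have h1 : ∀ᶠ q in 𝓝 (0 : ℂ × ℂ), Shi a A B q ∈ ball (0 : ℂ × ℂ) 1 := by
      refine hShic.continuousAt.eventually (isOpen_ball.mem_nhds ?_)
      rw [Shi_zero]; exact mem_ball_self one_pos
    filter_upwards [h1] with q hq
    have h2 := hx3 n _ (ball_subset_closedBall hq)
    rw [h0, norm_zero] at h2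
    have h3 := norm_le_zero_iff.1 h2
    simp only [hd, Sh_Shi a hA hB] at h3
    exact sub_eq_zero.1 h3
  have hη : Tendsto η atTop (𝓝 0) := by
    refine squeeze_zero (fun n => (hη0 n).le) (fun n => ?_) tendsto_one_div_add_atTop_nhds_zero_nat
    exact ((hn4 n _ (hShr _ (hxm n))).trans_le (min_le_right _ _)).le
  set f : ℕ → ℂ × ℂ → ℂ × ℂ × ℂ := fun n p => ((η n : ℂ))⁻¹ • d n p with hf
  have hfa : ∀ n, AnalyticOnNhd ℂ (f n) U := fun n p hp =>
    (hda n p hp).const_smul (c := ((η n : ℂ))⁻¹)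
  have hfn : ∀ n p, ‖f n p‖ = (η n)⁻¹ * ‖d n p‖ := fun n p => by
    simp only [hf]
    rw [norm_smul, norm_inv, Complex.norm_real, Real.norm_of_nonneg (hη0 n).le]
  have hfb : ∀ n, ∀ p ∈ closedBall (0 : ℂ × ℂ) 1, ‖f n p‖ ≤ 1 := by
    intro n p hp
    rw [hfn, inv_mul_le_iff₀ (hη0 n), mul_one]
    exact hx3 n p hp
  have hfx : ∀ n, ‖f n (x n)‖ = 1 := fun n => by
    rw [hfn]; exact inv_mul_cancel₀ (hη0 n).ne'
  have hfH : ∀ n p, Hn n (Sh a A B p) = H (Sh a A B p) + (η n : ℂ) • f n p := by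
    intro n p
    have : (η n : ℂ) ≠ 0 := by exact_mod_cast (hη0 n).ne'
    simp only [hf]
    rw [smul_inv_smul₀ this]
    simp [hd]
  -- compactness
  obtain ⟨⟨xs, v⟩, -, θ1, hθ1, hlim1⟩ :=
    ((isCompact_closedBall (0 : ℂ × ℂ) 1).prod
      (isCompact_closedBall (0 : ℂ × ℂ × ℂ) 1)).isSeqCompact (x := fun n => (x n, f n (x n)))
      (fun n => ⟨hxm n, by rw [mem_closedBall_zero_iff]; exact (hfx n).le⟩)
  have hxl : Tendsto (fun n => x (θ1 n)) atTop (𝓝 xs) := (continuous_fst.tendsto _).comp hlim1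
  have hvl : Tendsto (fun n => f (θ1 n) (x (θ1 n))) atTop (𝓝 v) :=
    (continuous_snd.tendsto _).comp hlim1
  have hxs1 : ‖xs.1‖ = 1 := by
    have := ((continuous_fst.norm).tendsto xs).comp hxl
    exact tendsto_nhds_unique this (tendsto_const_nhds.congr fun n => (hx1 _).symm)
  have hxs2 : ‖xs.2‖ ≤ 1 := by
    have := ((continuous_snd.norm).tendsto xs).comp hxl
    exact le_of_tendsto' this fun n => hx2 _
  have hv1 : ‖v‖ = 1 :=
    tendsto_nhds_unique hvl.norm (tendsto_const_nhds.congr fun n => (hfx _).symm)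
  obtain ⟨g, θ2, hθ2, hga, hgl⟩ := montel2 hUo (fun n => hfa (θ1 n)) hUb (fun n => hfb (θ1 n))
  have hη' : Tendsto (fun n => η (θ1 (θ2 n))) atTop (𝓝 0) :=
    hη.comp (hθ1.tendsto_atTop.comp hθ2.tendsto_atTop)
  -- the limit is an infinitesimal deformation
  have hinfd : IsInfDef φ ψ H (fun p => g (Shi a A B p)) := by
    refine limit_infdef hρ hρa hHa hH0 (Hn := fun n => Hn (θ1 (θ2 n))) hr hHm
      (fun n => hn3 _) (fun n => hn2 _) (fun n => hη0 _) hη' ?_ ?_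
    · refine (hga 0 (mem_ball_self one_pos)).comp_of_eq (Shi_analytic a A B 0) (Shi_zero a A B)
    · have h1 : ∀ᶠ q in 𝓝 (0 : ℂ × ℂ), Shi a A B q ∈ ball (0 : ℂ × ℂ) 1 := by
        refine hShic.continuousAt.eventually (isOpen_ball.mem_nhds ?_)
        rw [Shi_zero]; exact mem_ball_self one_pos
      filter_upwards [h1] with p hp
      refine (hgl (fun _ => Shi a A B p) _ hp tendsto_const_nhds).congr fun n => ?_
      simp only [hf, hd, Sh_Shi a hA hB]
      rw [← Complex.ofReal_inv, Complex.coe_smul]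
  have hg0 : ∀ p ∈ ball (0 : ℂ × ℂ) 1, g p = 0 := by
    have h1 := hinf _ hinfd
    have h2 : Tendsto (Sh a A B) (𝓝 0) (𝓝 0) := by
      have := hShc.tendsto 0
      rwa [Sh_zero] at this
    have h3 := h2.eventually h1
    simp only [Shi_Sh a hA hB] at h3
    intro p hp
    exact hga.eqOn_zero_of_preconnected_of_eventuallyEq_zero
      (convex_ball (0 : ℂ × ℂ) 1).isPreconnected (mem_ball_self one_pos) h3 hp
  -- conclusion
  obtain ⟨χ₀, hχ1, hχ2⟩ := hgeo xs hxs1 hxs2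
  have hfin := final_step (σ := σ) (R := R) (H := H) (Hn := fun n => Hn (θ1 (θ2 n)))
    (f := fun n => f (θ1 (θ2 n))) (r := r) (ρ := min ρ1 ρ2) hA hB hHr hRa
    (fun y hy => hσy y (ball_subset_ball (min_le_left _ _) hy))
    (fun y hy => hrefl H hHr hHm (fun p hp => by simpa using hδ0) y
      (ball_subset_ball (min_le_left _ _) hy))
    (fun n y hy => hrefl (Hn (θ1 (θ2 n))) (hn1 _) (hn3 _)
      (fun p hp => (hn4 _ p hp).trans_le (min_le_left _ _)) y
      (ball_subset_ball (min_le_left _ _) hy))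
    (fun n => hη0 _) hη' (fun n p => hfH _ p)
    (fun y p hp hy => by
      have := hgl y p hp hy
      rwa [hg0 p hp] at this)
    (hxl.comp hθ2.tendsto_atTop) (hvl.comp hθ2.tendsto_atTop) hχ1 hχ2
  have hv0 := hnd ((Sh a A B xs).1, χ₀, (Sh a A B xs).2)
    (ball_subset_ball (min_le_right _ _) hχ1) v hfin
  rw [hv0, norm_zero] at hv1
  exact zero_ne_one hv1
end

section
/- Fix ε ∈ {−1,1}. Let F be holomorphic near 0 ∈ ℂ² with F(0)=0, ∂F/∂z(0)=0 and ∂²F/∂z²(0) ≠ 0, and set H(z,w) := (z, F(z,w), w). Let γ' = (λ',r',U',c') ∈ (0,∞)×ℝ×U_ε×ℂ² and suppose that all partial derivatives at 0 of total order at most 2 of σ'_{γ'}∘H agree with the corresponding partial derivatives at 0 of H. Then λ' = 1, r' = 0, U' is the identity matrix and c' = 0; in particular σ'_{γ'} is the identity map. -/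
open Complex Filter Topology

/-- `∂/∂z` for holomorphic functions on `ℂ²`. -/
noncomputable def dzOp (f : ℂ × ℂ → ℂ) : ℂ × ℂ → ℂ := fun p => fderiv ℂ f p (1, 0)

/-- `∂/∂w` for holomorphic functions on `ℂ²`. -/
noncomputable def dwOp (f : ℂ × ℂ → ℂ) : ℂ × ℂ → ℂ := fun p => fderiv ℂ f p (0, 1)

/-- `U_ε`: the unitary group `U(2)` for `ε = 1`, and `U(1,1)` for `ε = −1`. -/
def UepsSet (ε : ℝ) : Set (Matrix (Fin 2) (Fin 2) ℂ) :=
  if ε = 1 then {U | U.conjTranspose * U = 1}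
  else {U | U.conjTranspose * Matrix.diagonal ![1, -1] * U = Matrix.diagonal ![1, -1]}

/-- The automorphism `σ'_{γ'}` of `ℍ³_ε` attached to `γ' = (λ',r',U',c')`. -/
noncomputable def sigmaMap' (ε lam' r' : ℝ) (U' : Matrix (Fin 2) (Fin 2) ℂ)
    (c' : Fin 2 → ℂ) : (Fin 2 → ℂ) × ℂ → (Fin 2 → ℂ) × ℂ := fun q =>
  ((fun i => ((lam' : ℂ) * U'.mulVec (fun j => q.1 j + c' j * q.2) i)
      / (1 - 2 * Complex.I * ((starRingEnd ℂ) (c' 0) * q.1 0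
            + (ε : ℂ) * ((starRingEnd ℂ) (c' 1) * q.1 1))
          + ((r' : ℂ) - Complex.I * ((Complex.normSq (c' 0) : ℂ)
              + (ε : ℂ) * (Complex.normSq (c' 1) : ℂ))) * q.2)),
   ((lam' : ℂ) ^ 2 * q.2)
      / (1 - 2 * Complex.I * ((starRingEnd ℂ) (c' 0) * q.1 0
            + (ε : ℂ) * ((starRingEnd ℂ) (c' 1) * q.1 1))
          + ((r' : ℂ) - Complex.I * ((Complex.normSq (c' 0) : ℂ)
              + (ε : ℂ) * (Complex.normSq (c' 1) : ℂ))) * q.2))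

noncomputable def dirD (v : ℂ × ℂ) (f : ℂ × ℂ → ℂ) : ℂ × ℂ → ℂ := fun p => fderiv ℂ f p v

lemma dirD_an (v : ℂ × ℂ) {f : ℂ × ℂ → ℂ} {p : ℂ × ℂ} (hf : AnalyticAt ℂ f p) :
    AnalyticAt ℂ (dirD v f) p :=
  ((ContinuousLinearMap.apply ℂ ℂ v).analyticAt _).comp hf.fderiv

lemma dirD_congr (v : ℂ × ℂ) {f g : ℂ × ℂ → ℂ} {p : ℂ × ℂ} (h : f =ᶠ[𝓝 p] g) :
    dirD v f =ᶠ[𝓝 p] dirD v g := by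
  filter_upwards [h.fderiv (𝕜 := ℂ)] with q hq
  simp only [dirD, hq]

lemma dirD_mul (v : ℂ × ℂ) {f g : ℂ × ℂ → ℂ} {p : ℂ × ℂ} (hf : AnalyticAt ℂ f p)
    (hg : AnalyticAt ℂ g p) :
    dirD v (fun q => f q * g q) =ᶠ[𝓝 p] fun q => dirD v f q * g q + f q * dirD v g q := by
  filter_upwards [hf.eventually_analyticAt, hg.eventually_analyticAt] with q hq1 hq2
  simp only [dirD]
  rw [fderiv_fun_mul hq1.differentiableAt hq2.differentiableAt]
  simp
  ring

lemma dirD_add (v : ℂ × ℂ) {f g : ℂ × ℂ → ℂ} {p : ℂ × ℂ} (hf : AnalyticAt ℂ f p)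
    (hg : AnalyticAt ℂ g p) :
    dirD v (fun q => f q + g q) =ᶠ[𝓝 p] fun q => dirD v f q + dirD v g q := by
  filter_upwards [hf.eventually_analyticAt, hg.eventually_analyticAt] with q hq1 hq2
  simp only [dirD]
  rw [fderiv_fun_add hq1.differentiableAt hq2.differentiableAt]
  simp

lemma dirD_mul2 (u v : ℂ × ℂ) {f g : ℂ × ℂ → ℂ} {p : ℂ × ℂ} (hf : AnalyticAt ℂ f p)
    (hg : AnalyticAt ℂ g p) :
    dirD u (dirD v (fun q => f q * g q)) p = dirD u (dirD v f) p * g p + dirD v f p * dirD u g p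
      + (dirD u f p * dirD v g p + f p * dirD u (dirD v g) p) := by
  rw [(dirD_congr u (dirD_mul v hf hg)).eq_of_nhds,
    (dirD_add u (f := fun q => dirD v f q * g q) (g := fun q => f q * dirD v g q)
      ((dirD_an v hf).mul hg) (hf.mul (dirD_an v hg))).eq_of_nhds,
    (dirD_mul u (dirD_an v hf) hg).eq_of_nhds, (dirD_mul u hf (dirD_an v hg)).eq_of_nhds]

/-- Affine combination of `1, z, F, w`. -/
noncomputable def aff (F : ℂ × ℂ → ℂ) (a b c d : ℂ) : ℂ × ℂ → ℂ :=
  fun p => a + b * p.1 + c * F p + d * p.2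

lemma aff_an {F : ℂ × ℂ → ℂ} {p : ℂ × ℂ} (hF : AnalyticAt ℂ F p) (a b c d : ℂ) :
    AnalyticAt ℂ (aff F a b c d) p := by
  unfold aff
  exact ((analyticAt_const.add (analyticAt_const.mul analyticAt_fst)).add
    (analyticAt_const.mul hF)).add (analyticAt_const.mul analyticAt_snd)

lemma aff_d {F : ℂ × ℂ → ℂ} {p : ℂ × ℂ} (hF : AnalyticAt ℂ F p) (a b c d : ℂ) (v : ℂ × ℂ) :
    dirD v (aff F a b c d) =ᶠ[𝓝 p] fun q => (b * v.1 + d * v.2) + c * dirD v F q := by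
  filter_upwards [hF.eventually_analyticAt] with q hq
  have h := ((((hasFDerivAt_fst (𝕜 := ℂ) (E := ℂ) (F := ℂ) (p := q)).const_mul b).const_add a).add
    (hq.differentiableAt.hasFDerivAt.const_mul c)).add
    ((hasFDerivAt_snd (𝕜 := ℂ) (E := ℂ) (F := ℂ) (p := q)).const_mul d)
  have h2 : HasFDerivAt (aff F a b c d) _ q := h
  simp only [dirD]
  rw [h2.fderiv]
  simp
  ring

lemma aff_dd {F : ℂ × ℂ → ℂ} {p : ℂ × ℂ} (hF : AnalyticAt ℂ F p) (a b c d : ℂ) (u v : ℂ × ℂ) :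
    dirD u (dirD v (aff F a b c d)) p = c * dirD u (dirD v F) p := by
  rw [(dirD_congr u (aff_d hF a b c d v)).eq_of_nhds,
    (dirD_add u (f := fun _ => b * v.1 + d * v.2) (g := fun q => c * dirD v F q)
      analyticAt_const (analyticAt_const.mul (dirD_an v hF))).eq_of_nhds,
    (dirD_mul u (f := fun _ => c) analyticAt_const (dirD_an v hF)).eq_of_nhds]
  simp [dirD]

/-- If `N / D` has the same first and second derivatives as `K`, compare `N` and `D * K`. -/
lemma key {F : ℂ × ℂ → ℂ} (hF : AnalyticAt ℂ F 0) (hF0 : F 0 = 0)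
    (nb nc nd db dc dd kb kc kd : ℂ) (G K : ℂ × ℂ → ℂ)
    (hG : G = fun p => aff F 0 nb nc nd p / aff F 1 db dc dd p)
    (hK : K = aff F 0 kb kc kd) :
    (∀ v, dirD v G 0 = dirD v K 0 →
      nb * v.1 + nd * v.2 + nc * dirD v F 0 = kb * v.1 + kd * v.2 + kc * dirD v F 0) ∧
    (∀ u v, dirD v G 0 = dirD v K 0 → dirD u G 0 = dirD u K 0 →
      dirD u (dirD v G) 0 = dirD u (dirD v K) 0 →
      nc * dirD u (dirD v F) 0 =
        (db * v.1 + dd * v.2 + dc * dirD v F 0) * (kb * u.1 + kd * u.2 + kc * dirD u F 0)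
        + (db * u.1 + dd * u.2 + dc * dirD u F 0) * (kb * v.1 + kd * v.2 + kc * dirD v F 0)
        + kc * dirD u (dirD v F) 0) := by
  have hD := aff_an hF 1 db dc dd
  have hN := aff_an hF 0 nb nc nd
  have hD0 : aff F 1 db dc dd 0 = 1 := by simp [aff, hF0]
  have hG0 : G 0 = 0 := by simp [hG, aff, hF0]
  have hGa : AnalyticAt ℂ G 0 := by
    rw [hG]; exact hN.div hD (by rw [hD0]; exact one_ne_zero)
  have hne : ∀ᶠ q in 𝓝 (0 : ℂ × ℂ), aff F 1 db dc dd q ≠ 0 :=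
    hD.continuousAt.eventually_ne (by rw [hD0]; exact one_ne_zero)
  have hNG : aff F 0 nb nc nd =ᶠ[𝓝 0] fun q => aff F 1 db dc dd q * G q := by
    filter_upwards [hne] with q hq
    rw [hG]; field_simp
  constructor
  · intro v h
    have e := (dirD_congr v hNG).eq_of_nhds
    rw [(dirD_mul v hD hGa).eq_of_nhds, hD0, hG0, h, hK, (aff_d hF _ _ _ _ v).eq_of_nhds,
      (aff_d hF _ db _ _ v).eq_of_nhds, (aff_d hF _ kb _ _ v).eq_of_nhds] at e
    linear_combination e
  · intro u v hv hu h
    have e := (dirD_congr u (dirD_congr v hNG)).eq_of_nhds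
    rw [dirD_mul2 u v hD hGa, hD0, hG0, h, hv, hu, hK, aff_dd hF, aff_dd hF, aff_dd hF,
      (aff_d hF _ db _ _ v).eq_of_nhds, (aff_d hF _ db _ _ u).eq_of_nhds,
      (aff_d hF _ kb _ _ v).eq_of_nhds, (aff_d hF _ kb _ _ u).eq_of_nhds] at e
    linear_combination e

/-- freeness of the target isotropy on jets of maps in normal form
`(z,w) ↦ (z, F(z,w), w)` with `F_z(0) = 0` and `F_{zz}(0) ≠ 0`. -/
theorem stmt_6 (ε : ℝ) (hε : ε = -1 ∨ ε = 1)
    (F : ℂ × ℂ → ℂ) (hFa : AnalyticAt ℂ F 0) (hF0 : F 0 = 0)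
    (hFz : dzOp F 0 = 0) (hFzz : dzOp (dzOp F) 0 ≠ 0)
    (H : ℂ × ℂ → (Fin 2 → ℂ) × ℂ) (hH : H = fun p => (![p.1, F p], p.2))
    (lam' : ℝ) (hlam' : 0 < lam') (r' : ℝ)
    (U' : Matrix (Fin 2) (Fin 2) ℂ) (hU' : U' ∈ UepsSet ε) (c' : Fin 2 → ℂ)
    (hjet : ∀ j k : ℕ, j + k ≤ 2 →
      ((dzOp^[j] (dwOp^[k] (fun p => (sigmaMap' ε lam' r' U' c' (H p)).1 0))) 0
          = (dzOp^[j] (dwOp^[k] (fun p => (H p).1 0))) 0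
        ∧ (dzOp^[j] (dwOp^[k] (fun p => (sigmaMap' ε lam' r' U' c' (H p)).1 1))) 0
          = (dzOp^[j] (dwOp^[k] (fun p => (H p).1 1))) 0
        ∧ (dzOp^[j] (dwOp^[k] (fun p => (sigmaMap' ε lam' r' U' c' (H p)).2))) 0
          = (dzOp^[j] (dwOp^[k] (fun p => (H p).2))) 0)) :
    lam' = 1 ∧ r' = 0 ∧ U' = 1 ∧ c' = 0
      ∧ ∀ q : (Fin 2 → ℂ) × ℂ, sigmaMap' ε lam' r' U' c' q = q := by
  subst hH
  set D1 : ℂ := -(2 * Complex.I * (starRingEnd ℂ) (c' 0)) with hD1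
  set D2 : ℂ := -(2 * Complex.I * ((ε : ℂ) * (starRingEnd ℂ) (c' 1))) with hD2
  set D3 : ℂ := ((r' : ℂ) - Complex.I * ((Complex.normSq (c' 0) : ℂ)
              + (ε : ℂ) * (Complex.normSq (c' 1) : ℂ))) with hD3
  have k0 := key hFa hF0 (lam' * U' 0 0) (lam' * U' 0 1) (lam' * (U' 0 0 * c' 0 + U' 0 1 * c' 1))
    D1 D2 D3 1 0 0
    (fun p => (sigmaMap' ε lam' r' U' c' (![p.1, F p], p.2)).1 0) (fun p => p.1)
    (by funext p
        simp only [sigmaMap', aff, Matrix.mulVec, dotProduct, Fin.sum_univ_two]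
        simp
        congr 1 <;> (try simp only [hD1, hD2, hD3]) <;> ring)
    (by funext p; simp [aff])
  have k1 := key hFa hF0 (lam' * U' 1 0) (lam' * U' 1 1) (lam' * (U' 1 0 * c' 0 + U' 1 1 * c' 1))
    D1 D2 D3 0 1 0
    (fun p => (sigmaMap' ε lam' r' U' c' (![p.1, F p], p.2)).1 1) (fun p => F p)
    (by funext p
        simp only [sigmaMap', aff, Matrix.mulVec, dotProduct, Fin.sum_univ_two]
        simp
        congr 1 <;> (try simp only [hD1, hD2, hD3]) <;> ring)
    (by funext p; simp [aff])
  have k2 := key hFa hF0 0 0 (lam' ^ 2)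
    D1 D2 D3 0 0 1
    (fun p => (sigmaMap' ε lam' r' U' c' (![p.1, F p], p.2)).2) (fun p => p.2)
    (by funext p
        simp only [sigmaMap', aff]
        simp
        congr 1; simp only [hD1, hD2, hD3]; ring)
    (by funext p; simp [aff])
  obtain ⟨a0, a1, a2⟩ := hjet 1 0 (by norm_num)
  obtain ⟨b0, b1, b2⟩ := hjet 0 1 (by norm_num)
  obtain ⟨c0, c1, c2⟩ := hjet 2 0 (by norm_num)
  obtain ⟨d0, d1, d2⟩ := hjet 1 1 (by norm_num)
  obtain ⟨e0, e1, e2⟩ := hjet 0 2 (by norm_num)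
  have hz : dirD (1, 0) F 0 = 0 := hFz
  have hzz : dirD (1, 0) (dirD (1, 0) F) 0 ≠ 0 := hFzz
  have z2 := k2.1 (0, 1) b2
  have zw2 := k2.2 (1, 0) (0, 1) b2 a2 d2
  have ww2 := k2.2 (0, 1) (0, 1) b2 b2 e2
  have z0 := k0.1 (1, 0) a0
  have zz0 := k0.2 (1, 0) (1, 0) a0 a0 c0
  have z1 := k1.1 (1, 0) a1
  have w1 := k1.1 (0, 1) b1
  have zz1 := k1.2 (1, 0) (1, 0) a1 a1 c1
  clear k0 k1 k2 hjet a0 a1 a2 b0 b1 b2 c0 c1 c2 d0 d1 d2 e0 e1 e2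
  simp only [hz, mul_zero, mul_one, zero_mul, one_mul, add_zero, zero_add] at z2 zw2 ww2 z0 zz0 z1 w1 zz1
  have hl : lam' = 1 := by
    have : lam' ^ 2 = 1 := by exact_mod_cast z2
    nlinarith
  subst hl
  simp only [Complex.ofReal_one, one_mul] at z0 zz0 z1 w1 zz1
  have hD1z : D1 = 0 := zw2.symm
  have hc0 : c' 0 = 0 := by simpa [hD1] using hD1z
  rw [hD1z] at zz0
  have u01 : U' 0 1 = 0 := by
    simpa [hzz] using zz0
  have u11 : U' 1 1 = 1 := by
    have : (U' 1 1 - 1) * dirD (1, 0) (dirD (1, 0) F) 0 = 0 := by linear_combination zz1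
    rcases mul_eq_zero.mp this with h | h
    · linear_combination h
    · exact absurd h hzz
  have hc1 : c' 1 = 0 := by
    rw [hc0, u11] at w1; linear_combination w1
  have hr : r' = 0 := by
    have h2 : D2 = 0 := by simp [hD2, hc1]
    have h3 : D3 = 0 := by rw [h2] at ww2; linear_combination -ww2 / 2
    simpa [hD3, hc0, hc1] using h3
  have hU : U' = 1 := by
    ext i j; fin_cases i <;> fin_cases j <;> simp [z0, z1, u01, u11]
  have hc : c' = 0 := by
    ext i; fin_cases i <;> simp [hc0, hc1]
  refine ⟨rfl, hr, hU, hc, ?_⟩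
  intro q
  rw [hr, hU, hc]
  ext <;> simp [sigmaMap']
end
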